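/- Let V : ℝ → ℝ be real analytic on all of ℝ and strongly convex, i.e. there exists c > 0 such that V''(x) ≥ c for all x ∈ ℝ. Then V is one-cut regular: there exist real numbers a < b, a function ψ : ℝ → ℝ continuous on [a,b], and a constant ℓ ∈ ℝ such that (i) ψ ≥ 0 on [a,b] and ∫_a^b ψ(x)dx = 1; (ii) ψ(x) > 0 for all x ∈ (a,b); (iii) the limits lim_{x→a⁺} ψ(x)/√(x−a) and lim_{x→b⁻} ψ(x)/√(b−x) exist and are nonzero; (iv) for all x ∈ [a,b], ∫_a^b log|t−x|^{−1} ψ(t)dt + ∫_a^b log|e^t−e^x|^{−1} ψ(t)dt + V(x) + ℓ = 0; and (v) for all x ∈ ℝ∖[a,b], ∫_a^b log|t−x|^{−1} ψ(t)dt + ∫_a^b log|e^t−e^x|^{−1} ψ(t)dt + V(x) + ℓ > 0. -/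

import Mathlib

open MeasureTheory Filter Set

/-- One-cut regular equilibrium data `(a, b, ψ, ℓ)` for the external field `V`:
conditions (i)–(v) of the paper, with the logarithmic integrals required to converge. -/
structure OneCutData (V : ℝ → ℝ) (a b : ℝ) (ψ : ℝ → ℝ) (ℓ : ℝ) : Prop where
  lt : a < b
  cont : ContinuousOn ψ (Icc a b)
  nonneg : ∀ x ∈ Icc a b, 0 ≤ ψ x
  total_mass : ∫ x in a..b, ψ x = 1
  pos : ∀ x ∈ Ioo a b, 0 < ψ x
  sqrt_left : ∃ L : ℝ, L ≠ 0 ∧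
    Tendsto (fun x => ψ x / Real.sqrt (x - a)) (nhdsWithin a (Ioi a)) (nhds L)
  sqrt_right : ∃ L : ℝ, L ≠ 0 ∧
    Tendsto (fun x => ψ x / Real.sqrt (b - x)) (nhdsWithin b (Iio b)) (nhds L)
  integrable_log : ∀ x ∈ Icc a b,
    IntervalIntegrable (fun t => -Real.log |t - x| * ψ t) volume a b
  integrable_explog : ∀ x ∈ Icc a b,
    IntervalIntegrable (fun t => -Real.log |Real.exp t - Real.exp x| * ψ t) volume a b
  var_eq : ∀ x ∈ Icc a b,
    (∫ t in a..b, -Real.log |t - x| * ψ t)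
      + (∫ t in a..b, -Real.log |Real.exp t - Real.exp x| * ψ t) + V x + ℓ = 0
  var_ineq : ∀ x : ℝ, x ∉ Icc a b →
    0 < (∫ t in a..b, -Real.log |t - x| * ψ t)
      + (∫ t in a..b, -Real.log |Real.exp t - Real.exp x| * ψ t) + V x + ℓ

namespace OneCut

open Real Topology

/-- Symmetric second difference. -/
def secondDiff (f : ℝ → ℝ) (x h : ℝ) : ℝ := f (x + h) + f (x - h) - 2 * f x

/-- The logarithmic kernel with smooth correction `G`. -/
noncomputable def logKer (G : ℝ → ℝ) (u : ℝ) : ℝ := -2 * Real.log u - G u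

/-- The potential on `[-1, 1]` of the density `φ` for the kernel `logKer G`. -/
noncomputable def potential (G φ : ℝ → ℝ) (y : ℝ) : ℝ :=
  ∫ t in (-1 : ℝ)..1, logKer G (y - t) * φ t

/-- Smooth corrections `G`, with derivatives `G₁`, `G₂`, for which `logKer G` is even and, on
the positive half line, convex and decreasing. -/
structure Admissible (G G₁ G₂ : ℝ → ℝ) : Prop where
  hasDeriv : ∀ u, HasDerivAt G (G₁ u) u
  hasDeriv₁ : ∀ u, HasDerivAt G₁ (G₂ u) u
  cont₂ : Continuous G₂
  even : ∀ u, G (-u) = G u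
  nonneg₂ : ∀ u, 0 ≤ G₂ u
  bound₂ : ∀ u, u ^ 2 * G₂ u ≤ 2

lemma secondDiff_ge {f f₁ f₂ : ℝ → ℝ} {c : ℝ} (h₁ : ∀ x, HasDerivAt f (f₁ x) x)
    (h₂ : ∀ x, HasDerivAt f₁ (f₂ x) x) (hc : ∀ x, c ≤ f₂ x) (x h : ℝ) :
    c * h ^ 2 ≤ secondDiff f x h := by
  have hq : ∀ x, HasDerivAt (fun x => f x - c / 2 * x ^ 2) (f₁ x - c * x) x := fun x => by
    have := (h₁ x).sub (((hasDerivAt_id' x).pow 2).const_mul (c / 2))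
    refine this.congr_deriv ?_
    simp; ring
  have hq₁ : ∀ x, HasDerivAt (fun x => f₁ x - c * x) (f₂ x - c) x := fun x => by
    have := (h₂ x).sub ((hasDerivAt_id' x).const_mul c)
    refine this.congr_deriv ?_
    simp
  have hconv : ConvexOn ℝ univ (fun x => f x - c / 2 * x ^ 2) := by
    refine convexOn_of_hasDerivWithinAt2_nonneg (f' := fun x => f₁ x - c * x)
      (f'' := fun x => f₂ x - c) convex_univ ?_ ?_ ?_ ?_
    · exact fun x _ => (hq x).continuousAt.continuousWithinAt
    · exact fun x _ => (hq x).hasDerivWithinAt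
    · exact fun x _ => (hq₁ x).hasDerivWithinAt
    · exact fun x _ => by linarith [hc x]
  have := hconv.2 (mem_univ (x + h)) (mem_univ (x - h)) (by norm_num : (0 : ℝ) ≤ 1 / 2)
    (by norm_num : (0 : ℝ) ≤ 1 / 2) (by norm_num)
  simp only [smul_eq_mul] at this
  rw [show 1 / 2 * (x + h) + 1 / 2 * (x - h) = x by ring] at this
  unfold secondDiff
  nlinarith [this]

lemma secondDiff_le {f f₁ f₂ : ℝ → ℝ} {c : ℝ} (h₁ : ∀ x, HasDerivAt f (f₁ x) x)
    (h₂ : ∀ x, HasDerivAt f₁ (f₂ x) x) (hc : ∀ x, f₂ x ≤ c) (x h : ℝ) :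
    secondDiff f x h ≤ c * h ^ 2 := by
  have := secondDiff_ge (f := fun x => - f x) (f₁ := fun x => - f₁ x) (f₂ := fun x => - f₂ x)
    (c := -c) (fun x => (h₁ x).neg) (fun x => (h₂ x).neg) (fun x => by linarith [hc x]) x h
  unfold secondDiff at *
  linarith

namespace Admissible
variable {G G₁ G₂ : ℝ → ℝ}

lemma continuous (hG : Admissible G G₁ G₂) : Continuous G :=
  continuous_iff_continuousAt.2 fun u => (hG.hasDeriv u).continuousAt

lemma continuous₁ (hG : Admissible G G₁ G₂) : Continuous G₁ :=
  continuous_iff_continuousAt.2 fun u => (hG.hasDeriv₁ u).continuousAt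

lemma odd₁ (hG : Admissible G G₁ G₂) (u : ℝ) : G₁ (-u) = - G₁ u := by
  have h1 := (hG.hasDeriv (-u)).comp u (hasDerivAt_neg u)
  have h2 : G ∘ Neg.neg = G := funext fun v => hG.even v
  rw [h2] at h1
  have := h1.unique (hG.hasDeriv u)
  linarith

lemma nonneg₁ (hG : Admissible G G₁ G₂) {u : ℝ} (hu : 0 ≤ u) : 0 ≤ G₁ u := by
  have h0 : G₁ 0 = 0 := by have := hG.odd₁ 0; simp at this; linarith
  rw [← h0]
  exact monotone_of_hasDerivAt_nonneg hG.hasDeriv₁ hG.nonneg₂ hu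

lemma exists_bound (hG : Admissible G G₁ G₂) : ∃ M, 0 ≤ M ∧ ∀ u, G₂ u ≤ M := by
  obtain ⟨M, hM⟩ := (isCompact_Icc (a := (-1 : ℝ)) (b := 1)).bddAbove_image
    hG.cont₂.continuousOn
  refine ⟨max M 2, le_max_of_le_right (by norm_num), fun u => ?_⟩
  by_cases hu : u ∈ Icc (-1 : ℝ) 1
  · exact le_max_of_le_left (hM (mem_image_of_mem _ hu))
  · refine le_max_of_le_right ?_
    have h1 : 1 ≤ u ^ 2 := by
      by_contra hlt
      exact hu (abs_le.1 ((sq_le_one_iff_abs_le_one u).1 (not_le.1 hlt).le))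
    nlinarith [hG.bound₂ u, hG.nonneg₂ u]

lemma logKer_even (hG : Admissible G G₁ G₂) (u : ℝ) : logKer G (-u) = logKer G u := by
  simp [logKer, hG.even]

lemma hasDerivAt_logKer (hG : Admissible G G₁ G₂) {u : ℝ} (hu : u ≠ 0) :
    HasDerivAt (logKer G) (-2 * u⁻¹ - G₁ u) u :=
  ((Real.hasDerivAt_log hu).const_mul (-2)).sub (hG.hasDeriv u)

lemma antitoneOn_logKer (hG : Admissible G G₁ G₂) : AntitoneOn (logKer G) (Ioi 0) := by
  refine antitoneOn_of_hasDerivWithinAt_nonpos (f' := fun u => -2 * u⁻¹ - G₁ u)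
    (convex_Ioi 0) ?_ ?_ ?_
  · exact fun u hu => (hG.hasDerivAt_logKer (ne_of_gt hu)).continuousAt.continuousWithinAt
  · intro u hu
    rw [interior_Ioi] at hu ⊢
    exact (hG.hasDerivAt_logKer (ne_of_gt hu)).hasDerivWithinAt
  · intro u hu
    rw [interior_Ioi] at hu
    have := hG.nonneg₁ (le_of_lt (mem_Ioi.1 hu))
    have h2 : 0 < u⁻¹ := inv_pos.2 hu
    linarith

lemma logKer_le_of_abs_le (hG : Admissible G G₁ G₂) {u v : ℝ} (hu : u ≠ 0) (h : |u| ≤ |v|) :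
    logKer G v ≤ logKer G u := by
  have key : ∀ w, logKer G |w| = logKer G w := fun w => by
    rcases abs_choice w with h | h <;> rw [h]
    exact hG.logKer_even w
  rw [← key u, ← key v]
  exact hG.antitoneOn_logKer (abs_pos.2 hu) ((abs_pos.2 hu).trans_le h) h

lemma convexOn_logKer (hG : Admissible G G₁ G₂) : ConvexOn ℝ (Ioi 0) (logKer G) := by
  refine convexOn_of_hasDerivWithinAt2_nonneg (f' := fun u => -2 * u⁻¹ - G₁ u)
      (f'' := fun u => -2 * (-(u ^ 2)⁻¹) - G₂ u) (convex_Ioi 0) ?_ ?_ ?_ ?_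
  · exact fun u hu => (hG.hasDerivAt_logKer (ne_of_gt hu)).continuousAt.continuousWithinAt
  · intro u hu
    rw [interior_Ioi] at hu ⊢
    exact (hG.hasDerivAt_logKer (ne_of_gt hu)).hasDerivWithinAt
  · intro u hu
    rw [interior_Ioi] at hu ⊢
    exact (((hasDerivAt_inv (ne_of_gt hu)).const_mul (-2)).sub (hG.hasDeriv₁ u)).hasDerivWithinAt
  · intro u hu
    rw [interior_Ioi] at hu
    have h2 : 0 < u ^ 2 := pow_pos hu 2
    have : G₂ u ≤ 2 * (u ^ 2)⁻¹ := by
      rw [← div_eq_mul_inv, le_div_iff₀ h2]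
      linarith [hG.bound₂ u]
    linarith

lemma secondDiff_logKer_nonneg (hG : Admissible G G₁ G₂) {u h : ℝ} (h0 : 0 < h) (hu : h < |u|) :
    0 ≤ secondDiff (logKer G) u h := by
  have main : ∀ u : ℝ, h < u → 0 ≤ secondDiff (logKer G) u h := by
    intro u hu
    have := hG.convexOn_logKer.2 (mem_Ioi.2 (by linarith : 0 < u + h))
      (mem_Ioi.2 (by linarith : 0 < u - h)) (by norm_num : (0 : ℝ) ≤ 1 / 2)
      (by norm_num : (0 : ℝ) ≤ 1 / 2) (by norm_num)
    simp only [smul_eq_mul] at this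
    rw [show 1 / 2 * (u + h) + 1 / 2 * (u - h) = u by ring] at this
    unfold secondDiff
    linarith
  rcases abs_choice u with h' | h' <;> rw [h'] at hu
  · exact main u hu
  · have := main (-u) hu
    unfold secondDiff at this ⊢
    rw [← hG.logKer_even u, ← hG.logKer_even (u + h), ← hG.logKer_even (u - h)]
    convert this using 2
    rw [add_comm]
    congr 2 <;> ring

lemma secondDiff_logKer_ge (hG : Admissible G G₁ G₂) {M : ℝ} (hM : ∀ u, G₂ u ≤ M) {u h : ℝ}
    (h0 : 0 < h) (hu : |u| ≤ h) (hu1 : u ≠ h) (hu2 : u ≠ -h) :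
    4 * Real.log u - 4 * Real.log h - M * h ^ 2 ≤ secondDiff (logKer G) u h := by
  have hd := secondDiff_le hG.hasDeriv hG.hasDeriv₁ hM u h
  have h1 : u + h ≠ 0 := fun h' => hu2 (by linarith)
  have h2 : u - h ≠ 0 := fun h' => hu1 (by linarith)
  have hl : Real.log (u + h) + Real.log (u - h) ≤ 2 * Real.log h := by
    rw [← Real.log_mul h1 h2, ← Real.log_abs, two_mul, ← Real.log_mul h0.ne' h0.ne']
    refine Real.log_le_log (abs_pos.2 (mul_ne_zero h1 h2)) ?_
    rw [abs_le] at *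
    constructor
    · nlinarith [sq_nonneg u]
    · nlinarith [mul_nonneg (sub_nonneg.2 hu.2) (by linarith [hu.1] : 0 ≤ u + h), sq_nonneg h]
  unfold secondDiff logKer at *
  linarith

end Admissible

lemma intervalIntegrable_log_sub (y a b : ℝ) :
    IntervalIntegrable (fun t => Real.log (y - t)) volume a b := by
  have := (intervalIntegral.intervalIntegrable_log' (a := y - a) (b := y - b)).comp_sub_left y
  simpa using this

lemma intervalIntegrable_logKer {G φ : ℝ → ℝ} (hG : Continuous G) {a b : ℝ}
    (hφ : ContinuousOn φ (uIcc a b)) (y : ℝ) :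
    IntervalIntegrable (fun t => logKer G (y - t) * φ t) volume a b := by
  refine IntervalIntegrable.mul_continuousOn ?_ hφ
  refine ((intervalIntegrable_log_sub y a b).const_mul (-2)).sub ?_
  exact (hG.comp (continuous_const.sub continuous_id)).intervalIntegrable _ _

lemma potential_add {G φ χ : ℝ → ℝ} (hG : Continuous G) (hφ : ContinuousOn φ (Icc (-1) 1))
    (hχ : ContinuousOn χ (Icc (-1) 1)) (y : ℝ) :
    potential G (fun t => φ t + χ t) y = potential G φ y + potential G χ y := by
  have hu : uIcc (-1 : ℝ) 1 = Icc (-1) 1 := uIcc_of_le (by norm_num)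
  unfold potential
  rw [← intervalIntegral.integral_add (intervalIntegrable_logKer hG (hu ▸ hφ) y)
    (intervalIntegrable_logKer hG (hu ▸ hχ) y)]
  exact intervalIntegral.integral_congr fun t _ => by ring

lemma potential_const_mul (G φ : ℝ → ℝ) (c y : ℝ) :
    potential G (fun t => c * φ t) y = c * potential G φ y := by
  unfold potential
  rw [← intervalIntegral.integral_const_mul]
  exact intervalIntegral.integral_congr fun t _ => by ring

lemma secondDiff_integral_logKer {G φ : ℝ → ℝ} (hG : Continuous G) {a b : ℝ}
    (hφ : ContinuousOn φ (uIcc a b)) (x h : ℝ) :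
    secondDiff (fun y => ∫ t in a..b, logKer G (y - t) * φ t) x h =
      ∫ t in a..b, secondDiff (logKer G) (x - t) h * φ t := by
  have h1 := intervalIntegrable_logKer hG hφ
  simp only [secondDiff]
  rw [← intervalIntegral.integral_const_mul, ← intervalIntegral.integral_add (h1 _) (h1 _),
    ← intervalIntegral.integral_sub ((h1 _).add (h1 _)) ((h1 _).const_mul 2)]
  refine intervalIntegral.integral_congr fun t _ => ?_
  rw [show x + h - t = x - t + h by ring, show x - h - t = x - t - h by ring]
  ring

lemma intervalIntegrable_secondDiff_logKer {G φ : ℝ → ℝ} (hG : Continuous G) {a b : ℝ}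
    (hφ : ContinuousOn φ (uIcc a b)) (x h : ℝ) :
    IntervalIntegrable (fun t => secondDiff (logKer G) (x - t) h * φ t) volume a b := by
  have h1 := intervalIntegrable_logKer hG hφ
  refine (((h1 (x + h)).add (h1 (x - h))).sub ((h1 x).const_mul 2)).congr fun t _ => ?_
  simp only [secondDiff]
  rw [show x + h - t = x - t + h by ring, show x - h - t = x - t - h by ring]
  ring

lemma secondDiff_potential_ge {G G₁ G₂ φ : ℝ → ℝ} (hG : Admissible G G₁ G₂)
    (hφ : ContinuousOn φ (Icc (-1) 1)) {M : ℝ} (hM0 : 0 ≤ M) (hM : ∀ u, G₂ u ≤ M)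
    (h0 : ∀ t ∈ Icc (-1 : ℝ) 1, 0 ≤ φ t) {x h δ : ℝ} (hh : 0 < h) (hh1 : h ≤ 1) (hδ : 0 ≤ δ)
    (hx : ∀ t ∈ Icc (-1 : ℝ) 1, |x - t| ≤ h → φ t ≤ δ) :
    -((8 + 2 * M) * h * δ) ≤ secondDiff (potential G φ) x h := by
  have hu : uIcc (-1 : ℝ) 1 = Icc (-1) 1 := uIcc_of_le (by norm_num)
  have hφ' : ContinuousOn φ (uIcc (-1) 1) := hu ▸ hφ
  unfold potential
  rw [secondDiff_integral_logKer hG.continuous hφ']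
  set m : ℝ → ℝ := fun u => M - 4 * (Real.log u - Real.log h) with hm
  have hmnn : ∀ u, |u| ≤ h → u ≠ 0 → 0 ≤ m u := fun u hu hu0 => by
    have : Real.log u ≤ Real.log h := by
      rw [← Real.log_abs u]
      exact Real.log_le_log (abs_pos.2 hu0) hu
    simp only [hm]; linarith
  have hmint : ∀ a b, IntervalIntegrable (fun t => m (x - t)) volume a b := fun a b =>
    intervalIntegrable_const.sub
      (((intervalIntegrable_log_sub x a b).sub intervalIntegrable_const).const_mul 4)
  set S : Set ℝ := Ioc (x - h) (x + h) with hS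
  have hSint : IntegrableOn (fun t => m (x - t)) S :=
    (intervalIntegrable_iff_integrableOn_Ioc_of_le (by linarith)).1 (hmint (x - h) (x + h))
  have hmval : ∫ t in S, m (x - t) = (8 + 2 * M) * h := by
    rw [hS, ← intervalIntegral.integral_of_le (by linarith),
      intervalIntegral.integral_comp_sub_left (fun u => m u) x]
    simp only [hm]
    rw [intervalIntegral.integral_sub intervalIntegrable_const
        ((intervalIntegral.intervalIntegrable_log'.sub intervalIntegrable_const).const_mul 4),
      intervalIntegral.integral_const_mul,
      intervalIntegral.integral_sub intervalIntegral.intervalIntegrable_log'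
        intervalIntegrable_const, integral_log]
    simp only [intervalIntegral.integral_const, smul_eq_mul]
    rw [show x - (x + h) = -h by ring, show x - (x - h) = h by ring, Real.log_neg_eq_log]
    ring
  have hae : ∀ᵐ t : ℝ, t ≠ x ∧ t ≠ x - h ∧ t ≠ x + h := by
    have : ∀ c : ℝ, ∀ᵐ t : ℝ, t ≠ c := fun c => by
      simp [ae_iff]
    filter_upwards [this x, this (x - h), this (x + h)] with t a b c using ⟨a, b, c⟩
  rw [intervalIntegral.integral_of_le (by norm_num)]
  have hi1 : IntegrableOn (fun t => secondDiff (logKer G) (x - t) h * φ t) (Ioc (-1) 1) :=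
    (intervalIntegrable_iff_integrableOn_Ioc_of_le (by norm_num)).1
      (intervalIntegrable_secondDiff_logKer hG.continuous hφ' x h)
  have hi2 : Integrable (S.indicator fun t => δ * m (x - t)) :=
    (integrable_indicator_iff measurableSet_Ioc).2 (hSint.const_mul δ)
  have hS' : ∀ t ∈ S, |x - t| ≤ h := fun t ht => by
    rw [abs_le]; constructor <;> linarith [ht.1, ht.2]
  have hnn : 0 ≤ᵐ[volume] S.indicator fun t => δ * m (x - t) := by
    filter_upwards [hae] with t ht
    by_cases htS : t ∈ S
    · rw [indicator_of_mem htS]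
      exact mul_nonneg hδ (hmnn _ (hS' t htS) (sub_ne_zero.2 ht.1.symm))
    · rw [indicator_of_notMem htS]; rfl
  have h1 : ∫ t in Ioc (-1 : ℝ) 1, S.indicator (fun t => δ * m (x - t)) t ≤
      (8 + 2 * M) * h * δ := by
    refine (setIntegral_le_integral hi2 hnn).trans (le_of_eq ?_)
    rw [integral_indicator measurableSet_Ioc, integral_const_mul, hmval]
    ring
  refine (neg_le_neg h1).trans ?_
  rw [← integral_neg]
  refine setIntegral_mono_on_ae hi2.neg.integrableOn hi1 measurableSet_Ioc ?_
  filter_upwards [hae] with t ht htI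
  have htI' : t ∈ Icc (-1 : ℝ) 1 := Ioc_subset_Icc_self htI
  by_cases htS : t ∈ S
  · rw [indicator_of_mem htS]
    have hm0 := hmnn _ (hS' t htS) (sub_ne_zero.2 ht.1.symm)
    have hD := hG.secondDiff_logKer_ge hM hh (hS' t htS)
      (fun h' => ht.2.1 (by linarith)) (fun h' => ht.2.2 (by linarith))
    have hD' : -m (x - t) ≤ secondDiff (logKer G) (x - t) h := by
      have : M * h ^ 2 ≤ M * 1 := mul_le_mul_of_nonneg_left (by nlinarith) hM0
      simp only [hm]
      linarith
    have h3 := mul_le_mul_of_nonneg_right hD' (h0 t htI')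
    have h4 := mul_le_mul_of_nonneg_left (hx t htI' (hS' t htS)) hm0
    linarith
  · rw [indicator_of_notMem htS, neg_zero]
    refine mul_nonneg (hG.secondDiff_logKer_nonneg hh ?_) (h0 t htI')
    by_contra hle
    rw [not_lt, abs_le] at hle
    refine htS ⟨lt_of_le_of_ne (by linarith) fun h' => ht.2.1 h'.symm, by linarith⟩

/-- The potential of the constant density `1` is concave on `[-1, 1]`. -/
lemma secondDiff_potential_one_nonpos {G G₁ G₂ : ℝ → ℝ} (hG : Admissible G G₁ G₂) {x h : ℝ}
    (hh : 0 < h) (h1 : -1 < x - h) (h2 : x + h < 1) :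
    secondDiff (potential G fun _ => 1) x h ≤ 0 := by
  have hint : ∀ a b, IntervalIntegrable (logKer G) volume a b := fun a b =>
    (intervalIntegral.intervalIntegrable_log'.const_mul (-2)).sub
      (hG.continuous.intervalIntegrable _ _)
  have hval : ∀ y, potential G (fun _ => 1) y =
      (∫ u in (0 : ℝ)..(1 + y), logKer G u) + ∫ u in (0 : ℝ)..(1 - y), logKer G u := by
    intro y
    unfold potential
    simp only [mul_one]
    rw [intervalIntegral.integral_comp_sub_left (fun u => logKer G u) y,
      ← intervalIntegral.integral_add_adjacent_intervals (hint (y - 1) 0) (hint 0 (y - -1)),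
      add_comm]
    congr 1
    · congr 1; ring
    · have := intervalIntegral.integral_comp_neg (f := logKer G) (a := 0) (b := 1 - y)
      simp only [hG.logKer_even] at this
      rw [this]
      congr 1 <;> ring
  have hconc : ∀ p, h < p → secondDiff (fun p => ∫ u in (0 : ℝ)..p, logKer G u) p h ≤ 0 := by
    intro p hp
    unfold secondDiff
    have e1 := intervalIntegral.integral_add_adjacent_intervals (hint 0 p) (hint p (p + h))
    have e2 := intervalIntegral.integral_add_adjacent_intervals (hint 0 (p - h)) (hint (p - h) p)
    have e3 : ∫ u in p..(p + h), logKer G u ≤ ∫ u in (p - h)..p, logKer G u := by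
      have := intervalIntegral.integral_comp_add_right (f := logKer G) (a := p - h) (b := p) h
      rw [show p - h + h = p by ring] at this
      rw [← this]
      refine intervalIntegral.integral_mono_on (by linarith) ?_ (hint _ _) ?_
      · have := (hint p (p + h)).comp_add_right h
        simpa using this
      · intro u hu
        have hpos : 0 < u := by linarith [hu.1]
        exact hG.antitoneOn_logKer hpos (by rw [mem_Ioi]; linarith) (by linarith)
    linarith
  have c1 := hconc (1 + x) (by linarith)
  have c2 := hconc (1 - x) (by linarith)
  unfold secondDiff at *
  rw [hval, hval, hval, show 1 + (x + h) = 1 + x + h by ring,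
    show 1 + (x - h) = 1 + x - h by ring, show 1 - (x + h) = 1 - x - h by ring,
    show 1 - (x - h) = 1 - x + h by ring]
  linarith

/-- Minimum principle: a density whose potential is, up to an affine function, strongly
concave, and which is nonnegative at the endpoints, is nonnegative. -/
lemma nonneg_of_strong {G G₁ G₂ φ f : ℝ → ℝ} (hG : Admissible G G₁ G₂)
    (hφ : ContinuousOn φ (Icc (-1) 1)) (hd : ∀ y ∈ Ioo (-1 : ℝ) 1, DifferentiableAt ℝ φ y)
    (hl : 0 ≤ φ (-1)) (hr : 0 ≤ φ 1) {c A B : ℝ} (hc : 0 < c)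
    (hf : ∀ x h, 0 < h → -1 < x - h → x + h < 1 → c * h ^ 2 ≤ secondDiff f x h)
    (heq : ∀ y ∈ Icc (-1 : ℝ) 1, potential G φ y + f y = A + B * y) :
    ∀ y ∈ Icc (-1 : ℝ) 1, 0 ≤ φ y := by
  obtain ⟨x, hxI, hxmin⟩ := isCompact_Icc.exists_isMinOn ⟨(0 : ℝ), by norm_num⟩ hφ
  by_contra! hcon
  obtain ⟨y, hy, hyneg⟩ := hcon
  have hxneg : φ x < 0 := lt_of_le_of_lt (hxmin hy) hyneg
  have hx1 : -1 < x := lt_of_le_of_ne hxI.1 fun h => by rw [← h] at hxneg; linarith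
  have hx2 : x < 1 := lt_of_le_of_ne hxI.2 fun h => by rw [h] at hxneg; linarith
  have hloc : IsLocalMin φ x := hxmin.isLocalMin (Icc_mem_nhds hx1 hx2)
  have hder : HasDerivAt φ 0 x := by
    have := (hd x ⟨hx1, hx2⟩).hasDerivAt
    rwa [hloc.deriv_eq_zero] at this
  obtain ⟨M, hM0, hM⟩ := hG.exists_bound
  set ε : ℝ := c / (2 * (8 + 2 * M)) with hε
  have hεpos : 0 < ε := by positivity
  have hlo := (hasDerivAt_iff_isLittleO.1 hder).def hεpos
  obtain ⟨r, hr0, hr⟩ := Metric.eventually_nhds_iff.1 hlo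
  set h : ℝ := min (min (r / 2) 1) (min ((x + 1) / 2) ((1 - x) / 2)) with hh
  have hh0 : 0 < h := by
    simp only [hh, lt_min_iff]
    refine ⟨⟨by linarith, one_pos⟩, by linarith, by linarith⟩
  have hhr : h < r := lt_of_le_of_lt ((min_le_left _ _).trans (min_le_left _ _)) (by linarith)
  have hh1 : h ≤ 1 := (min_le_left _ _).trans (min_le_right _ _)
  have hha : h ≤ (x + 1) / 2 := (min_le_right _ _).trans (min_le_left _ _)
  have hhb : h ≤ (1 - x) / 2 := (min_le_right _ _).trans (min_le_right _ _)
  have hη : ContinuousOn (fun t => φ t + -φ x) (Icc (-1) 1) := hφ.add continuousOn_const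
  have key := secondDiff_potential_ge hG hη hM0 hM (fun t ht => by linarith [isMinOn_iff.1 hxmin t ht])
    hh0 hh1 (δ := ε * h) (by positivity) (x := x) (fun t ht htx => by
      have h1 := hr (y := t) (by rw [Real.dist_eq, abs_sub_comm]; linarith)
      simp only [smul_zero, sub_zero, Real.norm_eq_abs] at h1
      have h2 := le_abs_self (φ t - φ x)
      rw [abs_sub_comm x t] at htx
      have := mul_le_mul_of_nonneg_left htx hεpos.le
      linarith)
  have hone := secondDiff_potential_one_nonpos hG (x := x) hh0 (by linarith) (by linarith)
  have hsplit : ∀ y, potential G (fun t => φ t + -φ x) y =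
      potential G φ y + (-φ x) * potential G (fun _ => 1) y := fun y => by
    rw [potential_add hG.continuous hφ continuousOn_const, ← potential_const_mul]
    simp
  have hf' := hf x h hh0 (by linarith) (by linarith)
  have e1 := heq (x + h) ⟨by linarith, by linarith⟩
  have e2 := heq (x - h) ⟨by linarith, by linarith⟩
  have e3 := heq x hxI
  have hp : (-φ x) * secondDiff (potential G fun _ => 1) x h ≤ 0 :=
    mul_nonpos_of_nonneg_of_nonpos (by linarith) hone
  have hfin : (8 + 2 * M) * h * (ε * h) = c / 2 * h ^ 2 := by
    rw [hε]; field_simp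
  unfold secondDiff at *
  rw [hsplit, hsplit, hsplit] at key
  have : 0 < c * h ^ 2 := by positivity
  nlinarith

section

open Polynomial (eval)
open Polynomial.Chebyshev

lemma integral_cos_natCast_mul {n : ℕ} (hn : n ≠ 0) : ∫ x in (0 : ℝ)..π, cos (n * x) = 0 := by
  have hn' : (n : ℝ) ≠ 0 := by exact_mod_cast hn
  rw [intervalIntegral.integral_comp_mul_left (fun x => cos x) hn', integral_cos]
  simp [sin_nat_mul_pi]

lemma continuous_eval_cos (p : Polynomial ℝ) : Continuous fun x : ℝ => eval (cos x) p :=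
  p.continuous.comp continuous_cos

lemma integral_U_even_cos (m : ℕ) : ∫ x in (0 : ℝ)..π, eval (cos x) (U ℝ ((2 * m : ℕ) : ℤ)) = π := by
  induction m with
  | zero => simp
  | succ k ih =>
    have h : ∀ x : ℝ, eval (cos x) (U ℝ ((2 * (k + 1) : ℕ) : ℤ))
        = 2 * cos ((2 * (k + 1) : ℕ) * x) + eval (cos x) (U ℝ ((2 * k : ℕ) : ℤ)) := fun x => by
      have := T_real_cos x ((2 * (k + 1) : ℕ) : ℤ)
      push_cast at this ⊢
      rw [← this, show (2 * ((k : ℤ) + 1)) = 2 * k + 2 by ring, U_eq_two_mul_T_add_U]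
      simp
    simp_rw [h]
    rw [intervalIntegral.integral_add, ih, intervalIntegral.integral_const_mul,
      integral_cos_natCast_mul (by omega)]
    · simp
    · exact (by fun_prop : Continuous _).intervalIntegrable _ _
    · exact (continuous_eval_cos _).intervalIntegrable _ _

lemma integral_log_sin_mul_cos {m : ℕ} (hm : m ≠ 0) :
    ∫ x in (0 : ℝ)..π, Real.log (sin x) * cos ((2 * m : ℕ) * x) = -π / (2 * m) := by
  have hm' : (m : ℝ) ≠ 0 := by exact_mod_cast hm
  set p := U ℝ ((2 * m : ℕ) - 1 : ℤ) with hp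
  have hps : ∀ x, eval (cos x) p * sin x = sin ((2 * m : ℕ) * x) := fun x => by
    have := U_real_cos x ((2 * m : ℕ) - 1 : ℤ)
    push_cast at this ⊢
    rw [hp]
    push_cast
    rw [this]; congr 1; ring
  have hcp : ∀ x, cos x * eval (cos x) p
      = eval (cos x) (U ℝ ((2 * m : ℕ) : ℤ)) - cos ((2 * m : ℕ) * x) := fun x => by
    have h1 := T_real_cos x ((2 * m : ℕ) : ℤ)
    rw [T_eq_U_sub_X_mul_U] at h1
    simp only [Polynomial.eval_sub, Polynomial.eval_mul, Polynomial.eval_X] at h1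
    push_cast at h1 ⊢
    rw [hp]
    push_cast
    linarith
  have hint1 : IntervalIntegrable (fun x => Real.log (sin x) * cos ((2 * m : ℕ) * x)) volume 0 π :=
    (intervalIntegrable_log_sin (a := 0) (b := π)).mul_continuousOn (by fun_prop)
  have hint2 : IntervalIntegrable (fun x => cos x * eval (cos x) p) volume 0 π :=
    (continuous_cos.mul (continuous_eval_cos _)).intervalIntegrable _ _
  have key := intervalIntegral.integral_eq_sub_of_hasDerivAt_of_le (a := 0) (b := π)
    (f := fun x => (sin x * Real.log (sin x)) * eval (cos x) p)
    (f' := fun x => cos x * eval (cos x) p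
      + (2 * m : ℕ) * (Real.log (sin x) * cos ((2 * m : ℕ) * x))) pi_pos.le
    ((Real.continuous_mul_log.comp continuous_sin).mul (continuous_eval_cos _)).continuousOn
    (fun x hx => by
      have hs : 0 < sin x := sin_pos_of_pos_of_lt_pi hx.1 hx.2
      have hd : HasDerivAt (fun x => Real.log (sin x) * sin ((2 * m : ℕ) * x))
          (cos x / sin x * sin ((2 * m : ℕ) * x)
            + Real.log (sin x) * (cos ((2 * m : ℕ) * x) * (2 * m : ℕ))) x := by
        refine ((hasDerivAt_sin x).log hs.ne').mul ?_
        simpa using ((hasDerivAt_id x).const_mul ((2 * m : ℕ) : ℝ)).sin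
      have he : (fun x => (sin x * Real.log (sin x)) * eval (cos x) p)
          = fun x => Real.log (sin x) * sin ((2 * m : ℕ) * x) := by
        ext x; rw [← hps]; ring
      rw [he]
      refine hd.congr_deriv ?_
      rw [← hps]
      field_simp)
    (hint2.add (hint1.const_mul _))
  rw [intervalIntegral.integral_add hint2 (hint1.const_mul _),
    intervalIntegral.integral_const_mul] at key
  simp_rw [hcp] at key
  rw [intervalIntegral.integral_sub ((continuous_eval_cos _).intervalIntegrable _ _)
    ((by fun_prop : Continuous _).intervalIntegrable _ _), integral_U_even_cos,
    integral_cos_natCast_mul (by omega)] at key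
  simp at key
  field_simp
  push_cast
  linarith

/-- Fourier cosine coefficients of `log |2 sin (β / 2)|` over a period. -/
noncomputable def logCoeff (m : ℕ) : ℝ :=
  ∫ β in (0 : ℝ)..2 * π, Real.log (sin (β / 2)) * cos (m * β)

lemma logCoeff_of_ne_zero {m : ℕ} (hm : m ≠ 0) : logCoeff m = -π / m := by
  have h := intervalIntegral.integral_comp_div
    (f := fun x => Real.log (sin x) * cos ((2 * m : ℕ) * x)) (a := 0) (b := 2 * π)
    (c := 2) two_ne_zero
  rw [zero_div, mul_div_cancel_left₀ _ two_ne_zero, integral_log_sin_mul_cos hm] at h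
  have hm' : (m : ℝ) ≠ 0 := by exact_mod_cast hm
  rw [logCoeff, show -π / m = (2 : ℝ) • (-π / (2 * m)) by simp; field_simp, ← h]
  congr 1; ext x; congr 2; push_cast; ring

lemma intervalIntegrable_log_sin_half (a b : ℝ) :
    IntervalIntegrable (fun β => Real.log (sin (β / 2))) volume a b := by
  have := (intervalIntegrable_log_sin (a := a / 2) (b := b / 2)).comp_mul_left (c := 1 / 2)
  simp only [Function.comp_def] at this
  convert this using 2
  · ring_nf
  · ring
  · ring

lemma integral_log_sin_half_mul_sin (m : ℕ) :
    ∫ β in (0 : ℝ)..2 * π, Real.log (sin (β / 2)) * sin (m * β) = 0 := by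
  have h := intervalIntegral.integral_comp_sub_left
    (f := fun β => Real.log (sin (β / 2)) * sin (m * β)) (a := 0) (b := 2 * π) (2 * π)
  rw [sub_self, sub_zero] at h
  have h2 : ∀ x : ℝ, Real.log (sin ((2 * π - x) / 2)) * sin (m * (2 * π - x))
      = -(Real.log (sin (x / 2)) * sin (m * x)) := fun x => by
    rw [show (2 * π - x) / 2 = π - x / 2 by ring, sin_pi_sub,
      show m * (2 * π - x) = m * (2 * π) - m * x by ring, sin_nat_mul_two_pi_sub]
    ring
  simp_rw [h2] at h
  rw [intervalIntegral.integral_neg] at h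
  linarith

lemma integral_log_cos_sub_cos (θ : ℝ) (m : ℕ) :
    ∫ α in (0 : ℝ)..π, Real.log (cos θ - cos α) * cos (m * α)
      = (∫ α in (0 : ℝ)..π, Real.log 2 * cos (m * α)) + logCoeff m * cos (m * θ) := by
  set P : ℝ → ℝ := fun β => Real.log (sin (β / 2)) with hP
  have hPper : ∀ β, P (β + 2 * π) = P β := fun β => by
    simp only [hP]
    rw [show (β + 2 * π) / 2 = β / 2 + π by ring, sin_add_pi, Real.log_neg_eq_log]
  have hPneg : ∀ β, P (-β) = P β := fun β => by
    simp only [hP]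
    rw [neg_div, sin_neg, Real.log_neg_eq_log]
  have hPint : ∀ a b, IntervalIntegrable P volume a b := intervalIntegrable_log_sin_half
  have hPint2 : ∀ a b, IntervalIntegrable (fun α => P (θ + α) * cos (m * α)) volume a b :=
    fun a b => by
      refine IntervalIntegrable.mul_continuousOn ?_ (by fun_prop)
      have := (hPint (a + θ) (b + θ)).comp_add_left θ
      simpa using this
  have hPint3 : ∀ a b, IntervalIntegrable (fun α => P (θ - α) * cos (m * α)) volume a b :=
    fun a b => by
      refine IntervalIntegrable.mul_continuousOn ?_ (by fun_prop)
      have := (hPint (θ - a) (θ - b)).comp_sub_left θ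
      simpa using this
  have hsplit : ∫ α in (0 : ℝ)..π, Real.log (cos θ - cos α) * cos (m * α)
      = ∫ α in (0 : ℝ)..π, (Real.log 2 * cos (m * α)
        + (P (θ + α) * cos (m * α) + P (θ - α) * cos (m * α))) := by
    refine intervalIntegral.integral_congr_ae ?_
    have hc : ({α | α ∈ uIoc 0 π ∧ cos α = cos θ} : Set ℝ).Subsingleton := by
      intro x hx y hy
      rw [uIoc_of_le pi_pos.le] at hx hy
      exact injOn_cos ⟨hx.1.1.le, hx.1.2⟩ ⟨hy.1.1.le, hy.1.2⟩ (hx.2.trans hy.2.symm)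
    have := hc.countable.ae_notMem volume
    filter_upwards [this] with α hα hα'
    have hne : cos α ≠ cos θ := fun h => hα ⟨hα', h⟩
    have hid := cos_sub_cos θ α
    have hne2 : sin ((θ + α) / 2) ≠ 0 ∧ sin ((θ - α) / 2) ≠ 0 := by
      constructor <;> intro h0 <;> rw [h0] at hid <;> exact hne (by linarith)
    rw [hid, Real.log_mul (mul_ne_zero (by norm_num) hne2.1) hne2.2,
      Real.log_mul (by norm_num) hne2.1, Real.log_neg_eq_log]
    simp only [hP]; ring
  rw [hsplit, intervalIntegral.integral_add ((by fun_prop : Continuous _).intervalIntegrable _ _)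
    ((hPint2 _ _).add (hPint3 _ _)), intervalIntegral.integral_add (hPint2 _ _) (hPint3 _ _)]
  congr 1
  have h3 : ∫ α in (0 : ℝ)..π, P (θ - α) * cos (m * α)
      = ∫ α in (-π)..0, P (θ + α) * cos (m * α) := by
    have := intervalIntegral.integral_comp_neg (f := fun α => P (θ + α) * cos (m * α))
      (a := 0) (b := π)
    rw [neg_zero] at this
    rw [← this]
    congr 1; ext x; rw [mul_neg, cos_neg]; rfl
  rw [h3, add_comm, intervalIntegral.integral_add_adjacent_intervals (hPint2 _ _) (hPint2 _ _)]
  have h4 := intervalIntegral.integral_comp_add_left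
    (f := fun β => P β * cos (m * (β - θ))) (a := -π) (b := π) θ
  simp only [add_sub_cancel_left] at h4
  rw [h4]
  have hper : Function.Periodic (fun β => P β * cos (m * (β - θ))) (2 * π) := fun β => by
    simp only [hPper]
    congr 1
    rw [show m * (β + 2 * π - θ) = m * (β - θ) + m * (2 * π) by ring, cos_add_nat_mul_two_pi]
  have h5 := hper.intervalIntegral_add_eq (θ + -π) 0
  rw [show θ + -π + 2 * π = θ + π by ring, zero_add] at h5
  rw [h5]
  have h6 : ∀ β, P β * cos (m * (β - θ)) = cos (m * θ) * (P β * cos (m * β))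
      + sin (m * θ) * (P β * sin (m * β)) := fun β => by
    rw [mul_sub, cos_sub]; ring
  simp_rw [h6]
  rw [intervalIntegral.integral_add, intervalIntegral.integral_const_mul,
    intervalIntegral.integral_const_mul, integral_log_sin_half_mul_sin, logCoeff]
  · simp only [hP]; ring
  · exact ((hPint _ _).mul_continuousOn (by fun_prop)).const_mul _
  · exact ((hPint _ _).mul_continuousOn (by fun_prop)).const_mul _

lemma integral_comp_cos (f : ℝ → ℝ) :
    ∫ t in (-1 : ℝ)..1, f t = ∫ α in (0 : ℝ)..π, sin α * f (cos α) := by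
  rw [intervalIntegral.integral_of_le (by norm_num), intervalIntegral.integral_of_le pi_pos.le,
    ← integral_Icc_eq_integral_Ioc, ← integral_Icc_eq_integral_Ioc, ← bijOn_cos.image_eq,
    integral_image_eq_integral_abs_deriv_smul measurableSet_Icc
      (fun x _ => (hasDerivAt_cos x).hasDerivWithinAt) injOn_cos]
  refine setIntegral_congr_fun measurableSet_Icc fun x hx => ?_
  simp [abs_of_nonneg (sin_nonneg_of_nonneg_of_le_pi hx.1 hx.2)]

lemma integral_log_sub_mul_U (n : ℕ) {θ : ℝ} (hint : ∀ k : ℕ, IntervalIntegrable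
      (fun α => Real.log (cos θ - cos α) * cos (k * α)) volume 0 π) :
    ∫ t in (-1 : ℝ)..1, Real.log (cos θ - t) * (√(1 - t ^ 2) * eval t (U ℝ (n : ℤ)))
      = 1 / 2 * ((∫ α in (0 : ℝ)..π, Real.log (cos θ - cos α) * cos (n * α))
        - ∫ α in (0 : ℝ)..π, Real.log (cos θ - cos α) * cos ((n + 2 : ℕ) * α)) := by
  rw [integral_comp_cos, ← intervalIntegral.integral_sub (hint n) (hint (n + 2)),
    ← intervalIntegral.integral_const_mul]
  refine intervalIntegral.integral_congr fun α hα => ?_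
  rw [uIcc_of_le pi_pos.le] at hα
  have hs := sin_nonneg_of_nonneg_of_le_pi hα.1 hα.2
  have h1 : √(1 - cos α ^ 2) = sin α := by
    rw [← sin_sq, sqrt_sq hs]
  have h2 := U_real_cos α (n : ℤ)
  have h3 := cos_sub_cos ((n : ℝ) * α) ((n + 2 : ℕ) * α)
  simp only [h1]
  rw [show (((n : ℝ) * α) + (n + 2 : ℕ) * α) / 2 = (n + 1) * α by push_cast; ring,
    show (((n : ℝ) * α) - (n + 2 : ℕ) * α) / 2 = -α by push_cast; ring, sin_neg] at h3
  push_cast at h2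
  rw [← h2] at h3
  calc _ = Real.log (cos θ - cos α) * (sin α * (eval (cos α) (U ℝ (n : ℤ)) * sin α)) := by ring
    _ = _ := by
      rw [← mul_sub, h3]; ring

lemma intervalIntegrable_log_sub_cos (θ : ℝ) :
    IntervalIntegrable (fun α => Real.log (cos θ - cos α)) volume 0 π := by
  have : MeromorphicOn (fun α => cos θ - cos α) (uIcc 0 π) := fun x _ =>
    (analyticAt_const.sub (analyticAt_cos)).meromorphicAt
  exact this.intervalIntegrable_log

/-- Divided difference of the Chebyshev polynomial of the first kind. -/
lemma integral_derivative_T_chord (n : ℤ) (y u : ℝ) :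
    (u - y) * ∫ s in (0 : ℝ)..1, eval (y + s * (u - y)) (Polynomial.derivative (T ℝ n))
      = eval u (T ℝ n) - eval y (T ℝ n) := by
  rw [← intervalIntegral.integral_const_mul]
  have := intervalIntegral.integral_eq_sub_of_hasDerivAt (a := 0) (b := 1)
    (f := fun s => eval (y + s * (u - y)) (T ℝ n))
    (f' := fun s => (u - y) * eval (y + s * (u - y)) (Polynomial.derivative (T ℝ n)))
    (fun s _ => by
      have h1 : HasDerivAt (fun s : ℝ => y + s * (u - y)) (u - y) s := by
        simpa using ((hasDerivAt_id s).mul_const (u - y)).const_add y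
      have := ((T ℝ n).hasDerivAt (y + s * (u - y))).comp s h1
      rw [mul_comm]; exact this)
    ((by fun_prop : Continuous _).intervalIntegrable _ _)
  rw [this]; simp

lemma integral_integral_derivative_T (n : ℕ) (y : ℝ) :
    ∫ α in (0 : ℝ)..π, ∫ s in (0 : ℝ)..1,
        eval (y + s * (cos α - y)) (Polynomial.derivative (T ℝ (n : ℤ)))
      = π * eval y (U ℝ ((n : ℤ) - 1)) := by
  set D : ℕ → ℝ → ℝ := fun n α => ∫ s in (0 : ℝ)..1,
        eval (y + s * (cos α - y)) (Polynomial.derivative (T ℝ (n : ℤ))) with hD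
  have hDc : ∀ n, Continuous (D n) := fun n => by
    refine intervalIntegral.continuous_parametric_intervalIntegral_of_continuous' ?_ _ _
    fun_prop
  have hrec : ∀ n, ∫ α in (0 : ℝ)..π, D (n + 2) α
      = ∫ α in (0 : ℝ)..π, (2 * y * D (n + 1) α + 2 * cos ((n + 1 : ℕ) * α) - D n α) := fun n => by
    refine intervalIntegral.integral_congr_ae ?_
    have hc : ({α | α ∈ uIoc 0 π ∧ cos α = y} : Set ℝ).Subsingleton := by
      intro a ha b hb
      rw [uIoc_of_le pi_pos.le] at ha hb
      exact injOn_cos ⟨ha.1.1.le, ha.1.2⟩ ⟨hb.1.1.le, hb.1.2⟩ (ha.2.trans hb.2.symm)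
    filter_upwards [hc.countable.ae_notMem volume] with α hα hα'
    have hne : cos α - y ≠ 0 := fun h => hα ⟨hα', by linarith⟩
    refine mul_left_cancel₀ hne ?_
    have e0 := integral_derivative_T_chord (n : ℤ) y (cos α)
    have e1 := integral_derivative_T_chord ((n + 1 : ℕ) : ℤ) y (cos α)
    have e2 := integral_derivative_T_chord ((n + 2 : ℕ) : ℤ) y (cos α)
    have ec := T_real_cos α ((n + 1 : ℕ) : ℤ)
    rw [show ((n + 2 : ℕ) : ℤ) = n + 2 by push_cast; ring, T_add_two] at e2
    simp only [hD]
    push_cast at e0 e1 e2 ec ⊢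
    simp only [Polynomial.eval_sub, Polynomial.eval_mul, Polynomial.eval_X,
      Polynomial.eval_ofNat] at e2
    rw [T_add_two, e2]
    rw [← ec]
    linear_combination (-2 * y) * e1 + e0
  have h0 : ∫ α in (0 : ℝ)..π, D 0 α = 0 := by simp [hD]
  have h1 : ∫ α in (0 : ℝ)..π, D 1 α = π := by simp [hD]
  have hstep : ∀ n, ∫ α in (0 : ℝ)..π, D (n + 2) α
      = 2 * y * (∫ α in (0 : ℝ)..π, D (n + 1) α) - ∫ α in (0 : ℝ)..π, D n α := fun n => by
    have hi := fun k => (hDc k).intervalIntegrable (μ := volume) 0 π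
    have hic : IntervalIntegrable (fun α : ℝ => 2 * cos ((n + 1 : ℕ) * α)) volume 0 π :=
      (by fun_prop : Continuous _).intervalIntegrable _ _
    rw [hrec, intervalIntegral.integral_sub (((hi _).const_mul _).add hic) (hi _),
      intervalIntegral.integral_add ((hi _).const_mul _) hic,
      intervalIntegral.integral_const_mul, intervalIntegral.integral_const_mul,
      integral_cos_natCast_mul (by omega)]
    ring
  have main : ∀ n, (∫ α in (0 : ℝ)..π, D n α = π * eval y (U ℝ ((n : ℤ) - 1))) ∧
      (∫ α in (0 : ℝ)..π, D (n + 1) α = π * eval y (U ℝ (n : ℤ))) := fun n => by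
    induction n with
    | zero => exact ⟨by simp [h0], by simp [h1]⟩
    | succ k ih =>
      refine ⟨by rw [ih.2]; push_cast; ring_nf, ?_⟩
      rw [hstep, ih.1, ih.2]
      push_cast
      rw [U_add_one]
      simp; ring
  exact (main n).1

/-- The square-root vanishing density on `[-1, 1]` whose logarithmic potential balances, up to
an affine function, an external field with second derivative `v`. -/
noncomputable def chebInv (v : ℝ → ℝ) (y : ℝ) : ℝ :=
  √(1 - y ^ 2) / (2 * π ^ 2) * ∫ α in (0 : ℝ)..π, ∫ s in (0 : ℝ)..1, v (y + s * (cos α - y))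

lemma intervalIntegrable_comp_cos {f : ℝ → ℝ} (hf : Continuous f) (a b : ℝ) :
    IntervalIntegrable (fun α => f (cos α)) volume a b :=
  (hf.comp continuous_cos).intervalIntegrable _ _

lemma continuous_integral_chord {v : ℝ → ℝ} (hv : Continuous v) (y : ℝ) :
    Continuous fun α => ∫ s in (0 : ℝ)..1, v (y + s * (cos α - y)) :=
  intervalIntegral.continuous_parametric_intervalIntegral_of_continuous' (by fun_prop) _ _

lemma continuous_integral_integral_chord {v : ℝ → ℝ} (hv : Continuous v) :
    Continuous fun y => ∫ α in (0 : ℝ)..π, ∫ s in (0 : ℝ)..1, v (y + s * (cos α - y)) := by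
  refine intervalIntegral.continuous_parametric_intervalIntegral_of_continuous' ?_ _ _
  exact intervalIntegral.continuous_parametric_intervalIntegral_of_continuous' (by fun_prop) _ _

lemma continuous_chebInv {v : ℝ → ℝ} (hv : Continuous v) : Continuous (chebInv v) := by
  unfold chebInv
  exact (by fun_prop : Continuous fun y : ℝ => √(1 - y ^ 2) / (2 * π ^ 2)).mul
    (continuous_integral_integral_chord hv)

lemma chebInv_add {v w : ℝ → ℝ} (hv : Continuous v) (hw : Continuous w) (y : ℝ) :
    chebInv (fun x => v x + w x) y = chebInv v y + chebInv w y := by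
  unfold chebInv
  rw [← mul_add, ← intervalIntegral.integral_add
    ((continuous_integral_chord hv y).intervalIntegrable _ _)
    ((continuous_integral_chord hw y).intervalIntegrable _ _)]
  congr 1
  refine intervalIntegral.integral_congr fun α _ => ?_
  exact intervalIntegral.integral_add ((by fun_prop : Continuous _).intervalIntegrable _ _)
    ((by fun_prop : Continuous _).intervalIntegrable _ _)

lemma chebInv_const_mul (v : ℝ → ℝ) (c y : ℝ) :
    chebInv (fun x => c * v x) y = c * chebInv v y := by
  unfold chebInv
  simp_rw [intervalIntegral.integral_const_mul]
  ring

lemma chord_mem {y α s : ℝ} (hy : y ∈ Icc (-1 : ℝ) 1) (hs : s ∈ Icc (0 : ℝ) 1) :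
    y + s * (cos α - y) ∈ Icc (-1 : ℝ) 1 := by
  have := (convex_Icc (-1 : ℝ) 1).add_smul_sub_mem hy ⟨neg_one_le_cos α, cos_le_one α⟩ hs
  simpa using this

lemma chebInv_congr {v w : ℝ → ℝ} (h : ∀ t ∈ Icc (-1 : ℝ) 1, v t = w t) {y : ℝ}
    (hy : y ∈ Icc (-1 : ℝ) 1) : chebInv v y = chebInv w y := by
  unfold chebInv
  congr 1
  refine intervalIntegral.integral_congr fun α _ => ?_
  refine intervalIntegral.integral_congr fun s hs => ?_
  rw [uIcc_of_le zero_le_one] at hs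
  exact h _ (chord_mem hy hs)

lemma abs_integral_integral_chord_le {v : ℝ → ℝ} {ε : ℝ} (h : ∀ t ∈ Icc (-1 : ℝ) 1, |v t| ≤ ε)
    {y : ℝ} (hy : y ∈ Icc (-1 : ℝ) 1) :
    |∫ α in (0 : ℝ)..π, ∫ s in (0 : ℝ)..1, v (y + s * (cos α - y))| ≤ π * ε := by
  have := intervalIntegral.norm_integral_le_of_norm_le_const (a := 0) (b := π) (C := ε)
    (f := fun α => ∫ s in (0 : ℝ)..1, v (y + s * (cos α - y))) (fun α _ => by
      have := intervalIntegral.norm_integral_le_of_norm_le_const (a := 0) (b := 1) (C := ε)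
        (f := fun s => v (y + s * (cos α - y))) (fun s hs => by
          rw [uIoc_of_le zero_le_one] at hs
          exact h _ (chord_mem hy (Ioc_subset_Icc_self hs)))
      simpa using this)
  rw [sub_zero, abs_of_pos pi_pos, Real.norm_eq_abs] at this
  linarith

lemma abs_chebInv_le {v : ℝ → ℝ} {ε : ℝ} (h : ∀ t ∈ Icc (-1 : ℝ) 1, |v t| ≤ ε)
    {y : ℝ} (hy : y ∈ Icc (-1 : ℝ) 1) : |chebInv v y| ≤ ε := by
  have hε : 0 ≤ ε := (abs_nonneg _).trans (h y hy)
  have h1 := abs_integral_integral_chord_le h hy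
  have h2 : √(1 - y ^ 2) ≤ 1 := by
    rw [sqrt_le_one]; nlinarith [sq_nonneg y]
  have h3 : √(1 - y ^ 2) / (2 * π ^ 2) ≤ 1 / π := by
    rw [div_le_div_iff₀ (by positivity) pi_pos]
    nlinarith [pi_gt_three, pi_pos]
  unfold chebInv
  rw [abs_mul, abs_of_nonneg (by positivity)]
  calc _ ≤ 1 / π * (π * ε) := mul_le_mul h3 h1 (abs_nonneg _) (by positivity)
    _ = ε := by field_simp

lemma chebInv_U (n : ℕ) (y : ℝ) :
    chebInv (fun t => eval t (U ℝ (n : ℤ))) y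
      = 1 / (2 * π * (n + 1)) * (√(1 - y ^ 2) * eval y (U ℝ (n : ℤ))) := by
  have hn : (n + 1 : ℝ) ≠ 0 := by positivity
  have h := integral_integral_derivative_T (n + 1) y
  have hd : Polynomial.derivative (T ℝ ((n + 1 : ℕ) : ℤ)) = ((n + 1 : ℕ) : Polynomial ℝ) * U ℝ (n : ℤ) := by
    rw [T_derivative_eq_U]; push_cast; ring_nf
  simp_rw [hd] at h
  simp only [Polynomial.eval_mul, Polynomial.eval_natCast, intervalIntegral.integral_const_mul] at h
  push_cast at h
  rw [add_sub_cancel_right] at h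
  unfold chebInv
  rw [show (∫ α in (0 : ℝ)..π, ∫ s in (0 : ℝ)..1, eval (y + s * (cos α - y)) (U ℝ (n : ℤ)))
    = π * eval y (U ℝ (n : ℤ)) / (n + 1) by field_simp; linarith]
  field_simp

lemma exists_integral_log_cos_sub_cos (m : ℕ) : ∃ c, ∀ θ,
    ∫ α in (0 : ℝ)..π, Real.log (cos θ - cos α) * cos (m * α) = c + -π / m * cos (m * θ) := by
  rcases eq_or_ne m 0 with rfl | hm
  · exact ⟨_, fun θ => by rw [integral_log_cos_sub_cos]; simp; rfl⟩
  · exact ⟨_, fun θ => by rw [integral_log_cos_sub_cos, logCoeff_of_ne_zero hm]⟩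

/-- The logarithmic potential of `chebInv v` balances `Φ` up to an affine function. -/
def Balances (v Φ Φ' : ℝ → ℝ) : Prop :=
  ∃ A, ∀ y ∈ Icc (-1 : ℝ) 1, -2 * (∫ t in (-1 : ℝ)..1, Real.log (y - t) * chebInv v t) + Φ y
    = A + 1 / π * (∫ α in (0 : ℝ)..π, Φ' (cos α)) * y

lemma intervalIntegrable_log_mul_chebInv {v : ℝ → ℝ} (hv : Continuous v) (y : ℝ) :
    IntervalIntegrable (fun t => Real.log (y - t) * chebInv v t) volume (-1) 1 := by
  refine IntervalIntegrable.mul_continuousOn ?_ (continuous_chebInv hv).continuousOn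
  have : MeromorphicOn (fun t => y - t) (uIcc (-1) 1) := fun x _ =>
    (analyticAt_const.sub analyticAt_id).meromorphicAt
  exact this.intervalIntegrable_log

lemma Balances.add {v Φ Φ' w Ψ Ψ' : ℝ → ℝ} (hv : Continuous v) (hw : Continuous w)
    (hΦ : Continuous Φ') (hΨ : Continuous Ψ') (h : Balances v Φ Φ') (h' : Balances w Ψ Ψ') :
    Balances (fun x => v x + w x) (fun x => Φ x + Ψ x) (fun x => Φ' x + Ψ' x) := by
  obtain ⟨A, hA⟩ := h
  obtain ⟨A', hA'⟩ := h'
  refine ⟨A + A', fun y hy => ?_⟩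
  have e := hA y hy
  have e' := hA' y hy
  simp_rw [chebInv_add hv hw, mul_add]
  rw [intervalIntegral.integral_add (intervalIntegrable_log_mul_chebInv hv y)
    (intervalIntegrable_log_mul_chebInv hw y), intervalIntegral.integral_add
      (intervalIntegrable_comp_cos hΦ _ _) (intervalIntegrable_comp_cos hΨ _ _)]
  linarith

lemma Balances.const_mul {v Φ Φ' : ℝ → ℝ} (h : Balances v Φ Φ') (c : ℝ) :
    Balances (fun x => c * v x) (fun x => c * Φ x) (fun x => c * Φ' x) := by
  obtain ⟨A, hA⟩ := h
  refine ⟨c * A, fun y hy => ?_⟩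
  have e := hA y hy
  simp_rw [chebInv_const_mul, mul_left_comm _ c]
  rw [intervalIntegral.integral_const_mul, intervalIntegral.integral_const_mul]
  linear_combination c * e

lemma exists_balances_U (n : ℕ) : ∃ q : Polynomial ℝ,
    Polynomial.derivative (Polynomial.derivative q) = U ℝ (n : ℤ) ∧
    Balances (fun t => eval t (U ℝ (n : ℤ))) (fun t => eval t q)
      (fun t => eval t (Polynomial.derivative q)) := by
  have hd : ∀ k : ℕ, Polynomial.derivative (Polynomial.C (1 / (k : ℝ)) * T ℝ (k : ℤ))
      = U ℝ ((k : ℤ) - 1) := fun k => by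
    rcases eq_or_ne k 0 with rfl | hk
    · simp
    · have hk' : (k : ℝ) ≠ 0 := by exact_mod_cast hk
      rw [Polynomial.derivative_C_mul, T_derivative_eq_U, ← mul_assoc, Int.cast_natCast,
        ← Polynomial.C_eq_natCast, ← Polynomial.C_mul, one_div_mul_cancel hk']
      simp
  set q : Polynomial ℝ := Polynomial.C (1 / (2 * (n + 1 : ℝ))) *
    (Polynomial.C (1 / ((n + 2 : ℕ) : ℝ)) * T ℝ ((n + 2 : ℕ) : ℤ)
      - Polynomial.C (1 / (n : ℝ)) * T ℝ (n : ℤ)) with hq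
  have hn : (n + 1 : ℝ) ≠ 0 := by positivity
  have hq1 : Polynomial.derivative q
      = Polynomial.C (1 / ((n + 1 : ℕ) : ℝ)) * T ℝ ((n + 1 : ℕ) : ℤ) := by
    rw [hq, Polynomial.derivative_C_mul, Polynomial.derivative_sub, hd, hd]
    have := two_mul_T_eq_U_sub_U ℝ ((n : ℤ) - 1)
    rw [show ((n + 2 : ℕ) : ℤ) - 1 = (n : ℤ) - 1 + 2 by push_cast; ring, ← this,
      show ((n + 1 : ℕ) : ℤ) = (n : ℤ) - 1 + 2 by push_cast; ring, ← mul_assoc]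
    congr 1
    rw [show (2 : Polynomial ℝ) = Polynomial.C 2 from rfl, ← Polynomial.C_mul]
    congr 1; push_cast; field_simp
  refine ⟨q, by rw [hq1, hd]; push_cast; ring_nf, ?_⟩
  obtain ⟨c, hc⟩ := exists_integral_log_cos_sub_cos n
  obtain ⟨d, hdd⟩ := exists_integral_log_cos_sub_cos (n + 2)
  refine ⟨-1 / (2 * π * (n + 1)) * (c - d), fun y hy => ?_⟩
  obtain ⟨θ, rfl⟩ : ∃ θ, cos θ = y := ⟨arccos y, cos_arccos hy.1 hy.2⟩
  have hlast : ∫ α in (0 : ℝ)..π, eval (cos α) (Polynomial.derivative q) = 0 := by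
    rw [hq1]
    simp only [Polynomial.eval_mul, Polynomial.eval_C]
    rw [intervalIntegral.integral_const_mul]
    have : ∀ α : ℝ, eval (cos α) (T ℝ ((n + 1 : ℕ) : ℤ)) = cos ((n + 1 : ℕ) * α) := fun α => by
      rw [T_real_cos]; simp
    simp_rw [this, integral_cos_natCast_mul (Nat.succ_ne_zero n), mul_zero]
  rw [hlast]
  simp_rw [chebInv_U, mul_left_comm (Real.log _) (1 / (2 * π * ((n : ℝ) + 1)))]
  rw [intervalIntegral.integral_const_mul, integral_log_sub_mul_U, hc, hdd, hq]
  · simp only [Polynomial.eval_mul, Polynomial.eval_sub, Polynomial.eval_C, T_real_cos,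
      Int.cast_natCast]
    field_simp
    ring
  · exact fun k => (intervalIntegrable_log_sub_cos θ).mul_continuousOn (by fun_prop)

lemma mem_span_U (p : Polynomial ℝ) :
    p ∈ Submodule.span ℝ (Set.range fun n : ℕ => U ℝ (n : ℤ)) := by
  set S := Submodule.span ℝ (Set.range fun n : ℕ => U ℝ (n : ℤ)) with hS
  have hX : ∀ p ∈ S, Polynomial.X * p ∈ S := fun p hp => by
    induction hp using Submodule.span_induction with
    | mem x hx =>
      obtain ⟨n, rfl⟩ := hx
      have h1 : Polynomial.X * U ℝ (n : ℤ)
          = (1 / 2 : ℝ) • (U ℝ ((n + 1 : ℕ) : ℤ) + U ℝ ((n : ℤ) - 1)) := by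
        have : U ℝ ((n + 1 : ℕ) : ℤ) + U ℝ ((n : ℤ) - 1)
            = (2 : ℝ) • (Polynomial.X * U ℝ (n : ℤ)) := by
          push_cast
          rw [U_add_one, two_smul]; ring
        rw [this, smul_smul]; norm_num
      rw [h1]
      refine S.smul_mem _ (S.add_mem (Submodule.subset_span ⟨n + 1, rfl⟩) ?_)
      rcases n with _ | k
      · simp
      · exact Submodule.subset_span ⟨k, by simp⟩
    | zero => simp
    | add x y _ _ hx hy => rw [mul_add]; exact S.add_mem hx hy
    | smul a x _ hx => rw [mul_smul_comm]; exact S.smul_mem _ hx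
  induction p using Polynomial.induction_on with
  | C a =>
    have : Polynomial.C a = a • U ℝ ((0 : ℕ) : ℤ) := by
      simp [Polynomial.smul_eq_C_mul]
    rw [this]
    exact S.smul_mem _ (Submodule.subset_span ⟨0, rfl⟩)
  | add p q hp hq => exact S.add_mem hp hq
  | monomial n a h =>
    have : Polynomial.C a * Polynomial.X ^ (n + 1)
        = Polynomial.X * (Polynomial.C a * Polynomial.X ^ n) := by ring
    rw [this]; exact hX _ h

lemma exists_balances_polynomial (p : Polynomial ℝ) : ∃ q : Polynomial ℝ,
    Polynomial.derivative (Polynomial.derivative q) = p ∧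
    Balances (fun t => eval t p) (fun t => eval t q)
      (fun t => eval t (Polynomial.derivative q)) := by
  induction mem_span_U p using Submodule.span_induction with
  | mem x hx => obtain ⟨n, rfl⟩ := hx; exact exists_balances_U n
  | zero => exact ⟨0, by simp, 0, fun y _ => by simp [chebInv]⟩
  | add x y _ _ hx hy =>
    obtain ⟨q, h1, h2⟩ := hx
    obtain ⟨r, h3, h4⟩ := hy
    refine ⟨q + r, by simp [h1, h3], ?_⟩
    simpa using h2.add x.continuous y.continuous (Polynomial.continuous _)
      (Polynomial.continuous _) h4
  | smul a x _ hx =>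
    obtain ⟨q, h1, h2⟩ := hx
    refine ⟨a • q, by simp [h1], ?_⟩
    simpa using h2.const_mul a

lemma balances {v Φ Φ' : ℝ → ℝ} (hv : Continuous v) (h₁ : ∀ x, HasDerivAt Φ (Φ' x) x)
    (h₂ : ∀ x, HasDerivAt Φ' (v x) x) : Balances v Φ Φ' := by
  have hΦ' : Continuous Φ' := continuous_iff_continuousAt.2 fun x => (h₂ x).continuousAt
  set E : ℝ → ℝ := fun y => -2 * (∫ t in (-1 : ℝ)..1, Real.log (y - t) * chebInv v t) + Φ y
    - 1 / π * (∫ α in (0 : ℝ)..π, Φ' (cos α)) * y with hE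
  suffices h : ∀ y ∈ Icc (-1 : ℝ) 1, E y = E 0 from
    ⟨E 0, fun y hy => by have := h y hy; simp only [hE] at this ⊢; linarith⟩
  intro y hy
  -- bound by the approximation error
  set K : ℝ := 2 * (∫ t in (-1 : ℝ)..1, |Real.log (y - t)|)
    + 2 * (∫ t in (-1 : ℝ)..1, |Real.log (0 - t)|) + 2 with hK
  have hlogi : ∀ z : ℝ, IntervalIntegrable (fun t => Real.log (z - t)) volume (-1) 1 := fun z => by
    have : MeromorphicOn (fun t => z - t) (uIcc (-1) 1) := fun x _ =>
      (analyticAt_const.sub analyticAt_id).meromorphicAt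
    exact this.intervalIntegrable_log
  have h0m : (0 : ℝ) ∈ Icc (-1 : ℝ) 1 := by norm_num
  suffices hb : ∀ ε > 0, |E y - E 0| ≤ K * ε by
    have hK0 : 0 < K := by
      have h1 : 0 ≤ ∫ t in (-1 : ℝ)..1, |Real.log (y - t)| :=
        intervalIntegral.integral_nonneg (by norm_num) fun t _ => abs_nonneg _
      have h2 : 0 ≤ ∫ t in (-1 : ℝ)..1, |Real.log (0 - t)| :=
        intervalIntegral.integral_nonneg (by norm_num) fun t _ => abs_nonneg _
      linarith
    by_contra hne
    have hpos : 0 < |E y - E 0| := abs_pos.2 (sub_ne_zero.2 hne)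
    have := hb (|E y - E 0| / (2 * K)) (by positivity)
    rw [show K * (|E y - E 0| / (2 * K)) = |E y - E 0| / 2 by field_simp] at this
    linarith
  intro ε hε
  obtain ⟨p, hp⟩ := exists_polynomial_near_of_continuousOn (-1) 1 v hv.continuousOn ε hε
  obtain ⟨q, hq, A, hA⟩ := exists_balances_polynomial p
  set q' := Polynomial.derivative q with hq'
  set w : ℝ → ℝ := fun t => v t + -1 * eval t p with hw
  have hpc : Continuous fun t => -1 * eval t p := by fun_prop
  have hwc : Continuous w := hv.add hpc
  have hwε : ∀ t ∈ Icc (-1 : ℝ) 1, |w t| ≤ ε := fun t ht => by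
    rw [abs_le]
    have := abs_lt.1 (hp t ht)
    simp only [hw]; constructor <;> linarith
  set Ψ' : ℝ → ℝ := fun t => Φ' t - eval t q' with hΨ'
  set Ψ : ℝ → ℝ := fun t => Φ t - eval t q with hΨ
  have hd1 : ∀ t, HasDerivAt Ψ (Ψ' t) t := fun t => (h₁ t).sub (q.hasDerivAt t)
  have hd2 : ∀ t, HasDerivAt Ψ' (w t) t := fun t => by
    have := (h₂ t).sub (q'.hasDerivAt t)
    rw [hq] at this
    refine this.congr_deriv ?_
    simp [hw]; ring
  have hΨ'c : Continuous Ψ' := by fun_prop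
  have hsplit : ∀ z ∈ Icc (-1 : ℝ) 1, E z - A
      = -2 * (∫ t in (-1 : ℝ)..1, Real.log (z - t) * chebInv w t) + Ψ z
        - 1 / π * (∫ α in (0 : ℝ)..π, Ψ' (cos α)) * z := fun z hz => by
    have e := hA z hz
    simp only [hw, hE, hΨ', hΨ]
    simp_rw [chebInv_add hv hpc, chebInv_const_mul, mul_add]
    rw [intervalIntegral.integral_add (intervalIntegrable_log_mul_chebInv hv z),
      intervalIntegral.integral_sub (intervalIntegrable_comp_cos hΦ' _ _)
        (intervalIntegrable_comp_cos q'.continuous _ _)]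
    · simp_rw [mul_left_comm _ (-1 : ℝ)]
      rw [intervalIntegral.integral_const_mul]
      linarith
    · simp_rw [mul_left_comm _ (-1 : ℝ)]
      exact (intervalIntegrable_log_mul_chebInv p.continuous z).const_mul _
  have hlogb : ∀ z, |∫ t in (-1 : ℝ)..1, Real.log (z - t) * chebInv w t|
      ≤ (∫ t in (-1 : ℝ)..1, |Real.log (z - t)|) * ε := fun z => by
    rw [← intervalIntegral.integral_mul_const]
    refine (intervalIntegral.abs_integral_le_integral_abs (by norm_num)).trans ?_
    refine intervalIntegral.integral_mono_on (by norm_num)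
      (intervalIntegrable_log_mul_chebInv hwc z).abs ((hlogi z).abs.mul_const ε) fun t ht => ?_
    rw [abs_mul]
    exact mul_le_mul_of_nonneg_left (abs_chebInv_le hwε ht) (abs_nonneg _)
  -- the primitive is nearly affine
  have hlip : ∀ t ∈ Icc (-1 : ℝ) 1, |Ψ' t - Ψ' 0| ≤ ε := fun t ht => by
    have := (convex_Icc (-1 : ℝ) 1).norm_image_sub_le_of_norm_hasDerivWithin_le
      (f := Ψ') (f' := w) (C := ε) (fun x _ => (hd2 x).hasDerivWithinAt)
      (fun x hx => hwε x hx) h0m ht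
    refine this.trans ?_
    rw [sub_zero, Real.norm_eq_abs]
    exact mul_le_of_le_one_right hε.le (abs_le.2 ht)
  set B := 1 / π * ∫ α in (0 : ℝ)..π, Ψ' (cos α) with hB
  have hBb : |B - Ψ' 0| ≤ ε := by
    have h1 : B - Ψ' 0 = 1 / π * ∫ α in (0 : ℝ)..π, (Ψ' (cos α) - Ψ' 0) := by
      rw [intervalIntegral.integral_sub (intervalIntegrable_comp_cos hΨ'c _ _)
        intervalIntegrable_const]
      simp [hB]; field_simp
    have h2 := intervalIntegral.norm_integral_le_of_norm_le_const (a := 0) (b := π) (C := ε)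
      (f := fun α => Ψ' (cos α) - Ψ' 0) (fun α _ => hlip _ ⟨neg_one_le_cos α, cos_le_one α⟩)
    rw [h1, abs_mul, abs_of_pos (by positivity)]
    rw [sub_zero, abs_of_pos pi_pos, Real.norm_eq_abs] at h2
    calc _ ≤ 1 / π * (ε * π) := by gcongr
      _ = ε := by field_simp
  have hΨb : |Ψ y - Ψ 0 - B * y| ≤ 2 * ε := by
    have := (convex_Icc (-1 : ℝ) 1).norm_image_sub_le_of_norm_hasDerivWithin_le
      (f := fun t => Ψ t - B * t) (f' := fun t => Ψ' t - B) (C := 2 * ε)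
      (fun x _ => ((hd1 x).sub (by simpa using (hasDerivAt_id x).const_mul B)).hasDerivWithinAt)
      (fun x hx => by
        have e1 := abs_le.1 (hlip x hx)
        have e2 := abs_le.1 hBb
        rw [Real.norm_eq_abs, abs_le]; constructor <;> linarith) h0m hy
    rw [sub_zero, Real.norm_eq_abs, Real.norm_eq_abs] at this
    rw [show Ψ y - Ψ 0 - B * y = Ψ y - B * y - (Ψ 0 - B * 0) by ring]
    exact this.trans (mul_le_of_le_one_right (by positivity) (abs_le.2 hy))
  have e1 := hsplit y hy
  have e2 := hsplit 0 h0m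
  have b1 := abs_le.1 (hlogb y)
  have b2 := abs_le.1 (hlogb 0)
  have b3 := abs_le.1 hΨb
  rw [show E y - E 0 = (E y - A) - (E 0 - A) by ring, e1, e2, abs_le, hK]
  constructor <;> linarith

end

lemma hasDerivAt_parametric_integral {K K' : ℝ → ℝ → ℝ} (hK : Continuous (Function.uncurry K))
    (hK' : Continuous (Function.uncurry K')) (h : ∀ x t, HasDerivAt (fun x => K x t) (K' x t) x)
    (a b x : ℝ) : HasDerivAt (fun x => ∫ t in a..b, K x t) (∫ t in a..b, K' x t) x := by
  obtain ⟨C, hC⟩ := ((isCompact_closedBall x 1).prod (isCompact_uIcc (a := a) (b := b))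
    ).exists_bound_of_continuousOn hK'.continuousOn
  refine (intervalIntegral.hasDerivAt_integral_of_dominated_loc_of_deriv_le
    (F := K) (F' := K') (s := Metric.ball x 1) (bound := fun _ => C) (Metric.ball_mem_nhds x one_pos)
    ?_ ?_ ?_ ?_ intervalIntegrable_const ?_).2
  · exact Eventually.of_forall fun y => (by fun_prop : Continuous (K y)).aestronglyMeasurable
  · exact (by fun_prop : Continuous (K x)).intervalIntegrable _ _
  · exact (by fun_prop : Continuous (K' x)).aestronglyMeasurable
  · exact Eventually.of_forall fun t ht y hy =>
      hC (y, t) ⟨Metric.ball_subset_closedBall hy, uIoc_subset_uIcc ht⟩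
  · exact Eventually.of_forall fun t _ y _ => h y t

lemma continuous_parametric {K : ℝ → ℝ → ℝ} (hK : Continuous (Function.uncurry K)) (a b : ℝ) :
    Continuous fun x => ∫ t in a..b, K x t :=
  intervalIntegral.continuous_parametric_intervalIntegral_of_continuous' hK _ _

lemma hasDerivAt_integral_integral_chord {v v' : ℝ → ℝ} (hv : ∀ x, HasDerivAt v (v' x) x)
    (hv' : Continuous v') (y : ℝ) :
    HasDerivAt (fun y => ∫ α in (0 : ℝ)..π, ∫ s in (0 : ℝ)..1, v (y + s * (cos α - y)))
      (∫ α in (0 : ℝ)..π, ∫ s in (0 : ℝ)..1, v' (y + s * (cos α - y)) * (1 - s)) y := by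
  have hvc : Continuous v := continuous_iff_continuousAt.2 fun x => (hv x).continuousAt
  refine hasDerivAt_parametric_integral
    (K := fun y α => ∫ s in (0 : ℝ)..1, v (y + s * (cos α - y)))
    (K' := fun y α => ∫ s in (0 : ℝ)..1, v' (y + s * (cos α - y)) * (1 - s)) ?_ ?_ ?_ _ _ _
  · exact intervalIntegral.continuous_parametric_intervalIntegral_of_continuous' (by fun_prop) _ _
  · exact intervalIntegral.continuous_parametric_intervalIntegral_of_continuous' (by fun_prop) _ _
  · intro x α
    refine hasDerivAt_parametric_integral
      (K := fun y s => v (y + s * (cos α - y)))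
      (K' := fun y s => v' (y + s * (cos α - y)) * (1 - s)) (by fun_prop) (by fun_prop) ?_ _ _ _
    intro z s
    have h1 : HasDerivAt (fun z : ℝ => z + s * (cos α - z)) (1 - s) z := by
      refine ((hasDerivAt_id z).add (((hasDerivAt_id z).const_sub (cos α)).const_mul s)).congr_deriv ?_
      ring
    exact (hv _).comp z h1

lemma differentiableAt_chebInv {v v' : ℝ → ℝ} (hv : ∀ x, HasDerivAt v (v' x) x)
    (hv' : Continuous v') {y : ℝ} (hy : y ∈ Ioo (-1 : ℝ) 1) :
    DifferentiableAt ℝ (chebInv v) y := by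
  unfold chebInv
  refine DifferentiableAt.mul ?_ (hasDerivAt_integral_integral_chord hv hv' y).differentiableAt
  refine DifferentiableAt.div_const (DifferentiableAt.sqrt (by fun_prop) ?_) _
  have := hy.1; have := hy.2
  nlinarith

lemma chebInv_one (v : ℝ → ℝ) : chebInv v 1 = 0 := by simp [chebInv]

lemma chebInv_neg_one (v : ℝ → ℝ) : chebInv v (-1) = 0 := by simp [chebInv]

lemma chebInv_const_two_pi (y : ℝ) : chebInv (fun _ => 2 * π) y = √(1 - y ^ 2) := by
  simp [chebInv]
  field_simp

lemma tendsto_chebInv_div_right {v : ℝ → ℝ} (hv : Continuous v) :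
    ∃ l, Tendsto (fun y => chebInv v y / √(1 - y)) (𝓝[<] 1) (𝓝 l) := by
  have hc : Continuous fun y : ℝ => √(1 + y) / (2 * π ^ 2)
      * ∫ α in (0 : ℝ)..π, ∫ s in (0 : ℝ)..1, v (y + s * (cos α - y)) :=
    (by fun_prop : Continuous fun y : ℝ => √(1 + y) / (2 * π ^ 2)).mul
      (continuous_integral_integral_chord hv)
  refine ⟨_, ((hc.tendsto 1).mono_left nhdsWithin_le_nhds).congr' ?_⟩
  filter_upwards [self_mem_nhdsWithin] with y hy
  have hy' : (0 : ℝ) < 1 - y := sub_pos.2 hy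
  have : 0 < √(1 - y) := sqrt_pos.2 hy'
  unfold chebInv
  rw [show 1 - y ^ 2 = (1 - y) * (1 + y) by ring, sqrt_mul hy'.le]
  field_simp

lemma tendsto_chebInv_div_left {v : ℝ → ℝ} (hv : Continuous v) :
    ∃ l, Tendsto (fun y => chebInv v y / √(1 + y)) (𝓝[>] (-1)) (𝓝 l) := by
  have hc : Continuous fun y : ℝ => √(1 - y) / (2 * π ^ 2)
      * ∫ α in (0 : ℝ)..π, ∫ s in (0 : ℝ)..1, v (y + s * (cos α - y)) :=
    (by fun_prop : Continuous fun y : ℝ => √(1 - y) / (2 * π ^ 2)).mul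
      (continuous_integral_integral_chord hv)
  refine ⟨_, ((hc.tendsto (-1)).mono_left nhdsWithin_le_nhds).congr' ?_⟩
  filter_upwards [self_mem_nhdsWithin] with y hy
  have hy' : (0 : ℝ) < 1 + y := by linarith [mem_Ioi.1 hy]
  have : 0 < √(1 + y) := sqrt_pos.2 hy'
  unfold chebInv
  rw [show 1 - y ^ 2 = (1 + y) * (1 - y) by ring, sqrt_mul hy'.le]
  field_simp

/-- Convolution of `K` with a density on `[-1, 1]`. -/
noncomputable def conv (K φ : ℝ → ℝ) (y : ℝ) : ℝ := ∫ t in (-1 : ℝ)..1, K (y - t) * φ t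

lemma continuous_conv {K φ : ℝ → ℝ} (hK : Continuous K) (hφ : Continuous φ) :
    Continuous (conv K φ) := by
  unfold conv
  exact continuous_parametric (K := fun y t => K (y - t) * φ t) (by fun_prop) _ _

lemma hasDerivAt_conv {K K₁ φ : ℝ → ℝ} (hK : ∀ u, HasDerivAt K (K₁ u) u) (hK₁ : Continuous K₁)
    (hφ : Continuous φ) (y : ℝ) : HasDerivAt (conv K φ) (conv K₁ φ y) y := by
  have hKc : Continuous K := continuous_iff_continuousAt.2 fun x => (hK x).continuousAt
  refine hasDerivAt_parametric_integral (K := fun y t => K (y - t) * φ t)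
    (K' := fun y t => K₁ (y - t) * φ t) (by fun_prop) (by fun_prop) (fun x t => ?_) _ _ _
  exact (HasDerivAt.comp_sub_const x t (hK (x - t))).mul_const _

lemma potential_eq {G φ : ℝ → ℝ} (hG : Continuous G) (hφ : Continuous φ) (y : ℝ) :
    potential G φ y = -2 * (∫ t in (-1 : ℝ)..1, Real.log (y - t) * φ t) - conv G φ y := by
  unfold potential conv logKer
  rw [← intervalIntegral.integral_const_mul, ← intervalIntegral.integral_sub]
  · congr 1; ext t; ring
  · exact ((intervalIntegrable_log_sub y _ _).mul_continuousOn hφ.continuousOn).const_mul _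
  · exact (by fun_prop : Continuous _).intervalIntegrable _ _

/-- A fixed point of the inversion formula balances the external field `H` for the full kernel,
up to an affine function. -/
lemma potential_add_eq_affine {G G₁ G₂ H H₁ H₂ φ χ : ℝ → ℝ} (hG : Admissible G G₁ G₂)
    (hH : ∀ x, HasDerivAt H (H₁ x) x) (hH₁ : ∀ x, HasDerivAt H₁ (H₂ x) x) (hH₂ : Continuous H₂)
    (hφ : Continuous φ) (hχ : Continuous χ)
    (hfix : ∀ y ∈ Icc (-1 : ℝ) 1, φ y = chebInv (fun y => H₂ y - conv G₂ χ y) y) :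
    ∃ A, ∀ y ∈ Icc (-1 : ℝ) 1, potential G φ y + (H y + conv G φ y - conv G χ y)
      = A + 1 / π * (∫ α in (0 : ℝ)..π, (H₁ (cos α) - conv G₁ χ (cos α))) * y := by
  have hv : Continuous fun y => H₂ y - conv G₂ χ y := hH₂.sub (continuous_conv hG.cont₂ hχ)
  obtain ⟨A, hA⟩ := balances hv (Φ := fun y => H y - conv G χ y)
    (Φ' := fun y => H₁ y - conv G₁ χ y)
    (fun x => (hH x).sub (hasDerivAt_conv hG.hasDeriv hG.continuous₁ hχ x))
    (fun x => (hH₁ x).sub (hasDerivAt_conv hG.hasDeriv₁ hG.cont₂ hχ x))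
  refine ⟨A, fun y hy => ?_⟩
  rw [← hA y hy, potential_eq hG.continuous hφ]
  have : ∫ t in (-1 : ℝ)..1, Real.log (y - t) * φ t = ∫ t in (-1 : ℝ)..1, Real.log (y - t)
      * chebInv (fun y => H₂ y - conv G₂ χ y) t := by
    refine intervalIntegral.integral_congr fun t ht => ?_
    rw [uIcc_of_le (by norm_num)] at ht
    simp only [hfix t ht]
  rw [this]; ring

lemma barrier {G G₁ G₂ : ℝ → ℝ} (hG : Admissible G G₁ G₂) :
    ∃ A B, ∀ y ∈ Icc (-1 : ℝ) 1, potential G (fun t => √(1 - t ^ 2)) y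
      + (π * y ^ 2 + conv G (fun t => √(1 - t ^ 2)) y) = A + B * y := by
  obtain ⟨A, hA⟩ := potential_add_eq_affine (H := fun y => π * y ^ 2) (H₁ := fun y => 2 * π * y)
    (H₂ := fun _ => 2 * π) (φ := fun t => √(1 - t ^ 2)) (χ := fun _ => 0) hG
    (fun x => by
      refine ((hasDerivAt_pow 2 x).const_mul π).congr_deriv ?_
      simp; ring)
    (fun x => by simpa using (hasDerivAt_id x).const_mul (2 * π))
    continuous_const (by fun_prop) continuous_const
    (fun y _ => by simp [conv, ← chebInv_const_two_pi])
  exact ⟨A, _, fun y hy => by have := hA y hy; simp only [conv, mul_zero,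
    intervalIntegral.integral_zero, sub_zero] at this ⊢; exact this⟩

lemma secondDiff_add (f k : ℝ → ℝ) (x h : ℝ) :
    secondDiff (fun y => f y + k y) x h = secondDiff f x h + secondDiff k x h := by
  unfold secondDiff; ring

lemma secondDiff_const_mul (f : ℝ → ℝ) (c x h : ℝ) :
    secondDiff (fun y => c * f y) x h = c * secondDiff f x h := by
  unfold secondDiff; ring

lemma conv_nonneg {K φ : ℝ → ℝ} (hK : ∀ u, 0 ≤ K u) (hφ : ∀ t ∈ Icc (-1 : ℝ) 1, 0 ≤ φ t) (y : ℝ) :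
    0 ≤ conv K φ y :=
  intervalIntegral.integral_nonneg (by norm_num) fun t ht => mul_nonneg (hK _) (hφ t ht)

lemma secondDiff_barrier_ge {G G₁ G₂ : ℝ → ℝ} (hG : Admissible G G₁ G₂) (x h : ℝ) :
    2 * π * h ^ 2 ≤ secondDiff (fun y => π * y ^ 2 + conv G (fun t => √(1 - t ^ 2)) y) x h := by
  have hw : Continuous fun t : ℝ => √(1 - t ^ 2) := by fun_prop
  have := secondDiff_ge (c := 0) (hasDerivAt_conv hG.hasDeriv hG.continuous₁ hw)
    (hasDerivAt_conv hG.hasDeriv₁ hG.cont₂ hw)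
    (conv_nonneg hG.nonneg₂ fun t _ => sqrt_nonneg _) x h
  rw [secondDiff_add]
  have h2 : secondDiff (fun y => π * y ^ 2) x h = 2 * π * h ^ 2 := by unfold secondDiff; ring
  linarith

/-- Comparison principle: a density whose potential is, up to an affine function, concave, and
which is nonnegative at the endpoints, is nonnegative. -/
lemma nonneg_of_convex {G G₁ G₂ φ f : ℝ → ℝ} (hG : Admissible G G₁ G₂)
    (hφ : ContinuousOn φ (Icc (-1) 1)) (hd : ∀ y ∈ Ioo (-1 : ℝ) 1, DifferentiableAt ℝ φ y)
    (hl : 0 ≤ φ (-1)) (hr : 0 ≤ φ 1) {A B : ℝ}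
    (hf : ∀ x h, 0 < h → -1 < x - h → x + h < 1 → 0 ≤ secondDiff f x h)
    (heq : ∀ y ∈ Icc (-1 : ℝ) 1, potential G φ y + f y = A + B * y) :
    ∀ y ∈ Icc (-1 : ℝ) 1, 0 ≤ φ y := by
  intro y hy
  obtain ⟨A', B', hw⟩ := barrier hG
  have hwc : Continuous fun t : ℝ => √(1 - t ^ 2) := by fun_prop
  have hwc' : ∀ ε : ℝ, Continuous fun t : ℝ => ε * √(1 - t ^ 2) := fun ε => by fun_prop
  have key : ∀ ε > 0, 0 ≤ φ y + ε * √(1 - y ^ 2) := fun ε hε => by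
    refine nonneg_of_strong (φ := fun y => φ y + ε * √(1 - y ^ 2))
      (f := fun y => f y + ε * (π * y ^ 2 + conv G (fun t => √(1 - t ^ 2)) y))
      (c := ε * (2 * π)) (A := A + ε * A') (B := B + ε * B') hG
      (hφ.add (hwc' ε).continuousOn) (fun z hz => (hd z hz).add ?_) ?_ ?_
      (by positivity) (fun x h h0 h1 h2 => ?_) (fun z hz => ?_) y hy
    · refine DifferentiableAt.const_mul (DifferentiableAt.sqrt (by fun_prop) ?_) _
      have := hz.1; have := hz.2
      nlinarith
    · simpa using hl
    · simpa using hr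
    · rw [secondDiff_add, secondDiff_const_mul]
      have e1 := hf x h h0 h1 h2
      have e2 := mul_le_mul_of_nonneg_left (secondDiff_barrier_ge hG x h) hε.le
      linarith
    · rw [potential_add hG.continuous hφ (hwc' ε).continuousOn, potential_const_mul]
      have e1 := heq z hz
      have e2 := hw z hz
      linear_combination e1 + ε * e2
  by_contra! hcon
  have hs : √(1 - y ^ 2) ≤ 1 := by rw [sqrt_le_one]; nlinarith [sq_nonneg y]
  have := key (-φ y / 2) (by linarith)
  nlinarith

/-- The moments `∫₀¹ sᵏ cosh (s v) ds`; for `k = 0` this is `sinh v / v`, and for even `k` it is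
the derivative of order `k` of that function. -/
noncomputable def sinhcEven (k : ℕ) (v : ℝ) : ℝ := ∫ s in (0 : ℝ)..1, s ^ k * cosh (s * v)

/-- The moments `∫₀¹ sᵏ sinh (s v) ds`; for odd `k` this is the derivative of order `k` of
`sinh v / v`. -/
noncomputable def sinhcOdd (k : ℕ) (v : ℝ) : ℝ := ∫ s in (0 : ℝ)..1, s ^ k * sinh (s * v)

lemma continuous_sinhcEven (k : ℕ) : Continuous (sinhcEven k) :=
  continuous_parametric (K := fun v s => s ^ k * cosh (s * v)) (by fun_prop) _ _

lemma continuous_sinhcOdd (k : ℕ) : Continuous (sinhcOdd k) :=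
  continuous_parametric (K := fun v s => s ^ k * sinh (s * v)) (by fun_prop) _ _

lemma hasDerivAt_sinhcEven (k : ℕ) (v : ℝ) :
    HasDerivAt (sinhcEven k) (sinhcOdd (k + 1) v) v := by
  refine hasDerivAt_parametric_integral (K := fun v s => s ^ k * cosh (s * v))
    (K' := fun v s => s ^ (k + 1) * sinh (s * v)) (by fun_prop) (by fun_prop) (fun x t => ?_) _ _ _
  have := (((hasDerivAt_id x).const_mul t).cosh).const_mul (t ^ k)
  refine this.congr_deriv ?_
  simp; ring

lemma hasDerivAt_sinhcOdd (k : ℕ) (v : ℝ) :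
    HasDerivAt (sinhcOdd k) (sinhcEven (k + 1) v) v := by
  refine hasDerivAt_parametric_integral (K := fun v s => s ^ k * sinh (s * v))
    (K' := fun v s => s ^ (k + 1) * cosh (s * v)) (by fun_prop) (by fun_prop) (fun x t => ?_) _ _ _
  have := (((hasDerivAt_id x).const_mul t).sinh).const_mul (t ^ k)
  refine this.congr_deriv ?_
  simp; ring

lemma mul_sinhcEven_zero (v : ℝ) : v * sinhcEven 0 v = sinh v := by
  unfold sinhcEven
  rw [← intervalIntegral.integral_const_mul]
  have := intervalIntegral.integral_eq_sub_of_hasDerivAt (a := 0) (b := 1)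
    (f := fun s => sinh (s * v)) (f' := fun s => v * (s ^ 0 * cosh (s * v)))
    (fun s _ => by
      refine (((hasDerivAt_id s).mul_const v).sinh).congr_deriv ?_
      simp; ring) ((by fun_prop : Continuous _).intervalIntegrable _ _)
  rw [this]; simp

lemma sinhcEven_add_mul_sinhcOdd (v : ℝ) : sinhcEven 0 v + v * sinhcOdd 1 v = cosh v := by
  have h1 := (hasDerivAt_id v).mul (hasDerivAt_sinhcEven 0 v)
  have h2 : (id * sinhcEven 0) = sinh := funext mul_sinhcEven_zero
  rw [h2] at h1
  have := h1.unique (hasDerivAt_sinh v)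
  simpa using this

lemma two_mul_sinhcOdd_add (v : ℝ) : 2 * sinhcOdd 1 v + v * sinhcEven 2 v = sinh v := by
  have h1 := (hasDerivAt_sinhcEven 0 v).add ((hasDerivAt_id v).mul (hasDerivAt_sinhcOdd 1 v))
  have h2 : (sinhcEven 0 + id * sinhcOdd 1) = cosh := funext sinhcEven_add_mul_sinhcOdd
  rw [h2] at h1
  have := h1.unique (hasDerivAt_cosh v)
  simp at this
  linarith

lemma one_le_sinhcEven_zero (v : ℝ) : 1 ≤ sinhcEven 0 v := by
  have := intervalIntegral.integral_mono_on (a := 0) (b := 1) zero_le_one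
    (f := fun _ => (1 : ℝ)) (g := fun s => s ^ 0 * cosh (s * v)) (μ := volume)
    intervalIntegrable_const ((by fun_prop : Continuous _).intervalIntegrable _ _)
    (fun s _ => by simp)
  simpa [sinhcEven] using this

lemma sinhcEven_nonneg (k : ℕ) (v : ℝ) : 0 ≤ sinhcEven k v :=
  intervalIntegral.integral_nonneg zero_le_one fun _ hs =>
    mul_nonneg (pow_nonneg hs.1 _) (cosh_pos _).le

lemma sq_mul_sinhc_identity (v : ℝ) :
    v ^ 2 * (sinhcEven 2 v * sinhcEven 0 v - sinhcOdd 1 v ^ 2) = sinhcEven 0 v ^ 2 - 1 := by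
  have h1 := mul_sinhcEven_zero v
  have h2 := sinhcEven_add_mul_sinhcOdd v
  have h3 := two_mul_sinhcOdd_add v
  have h4 := cosh_sq v
  rw [← h2, ← h1] at h4
  rw [← h1] at h3
  linear_combination v * sinhcEven 0 v * h3 - h4

lemma sinhc_logConvex (v : ℝ) : 0 ≤ sinhcEven 2 v * sinhcEven 0 v - sinhcOdd 1 v ^ 2 := by
  rcases eq_or_ne v 0 with rfl | hv
  · have : sinhcOdd 1 0 = 0 := by simp [sinhcOdd]
    rw [this]
    have := mul_nonneg (sinhcEven_nonneg 2 0) (sinhcEven_nonneg 0 0)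
    simpa
  · have h := sq_mul_sinhc_identity v
    have h1 := one_le_sinhcEven_zero v
    have hv2 : 0 < v ^ 2 := by positivity
    refine nonneg_of_mul_nonneg_right (a := v ^ 2) ?_ hv2
    rw [h]; nlinarith

lemma sinhcEven_neg (k : ℕ) (v : ℝ) : sinhcEven k (-v) = sinhcEven k v := by
  simp [sinhcEven]

lemma abs_sinhcOdd_le (v : ℝ) : |sinhcOdd 1 v| ≤ sinhcEven 0 v := by
  unfold sinhcOdd sinhcEven
  refine (intervalIntegral.abs_integral_le_integral_abs zero_le_one).trans ?_
  refine intervalIntegral.integral_mono_on zero_le_one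
    ((by fun_prop : Continuous _).intervalIntegrable _ _)
    ((by fun_prop : Continuous _).intervalIntegrable _ _) fun s hs => ?_
  rw [abs_mul, pow_one, pow_zero, one_mul, abs_of_nonneg hs.1]
  have h1 : |sinh (s * v)| ≤ cosh (s * v) := by
    rw [abs_le]
    constructor
    · have := exp_pos (s * v); rw [← cosh_add_sinh] at this; linarith
    · exact (sinh_lt_cosh _).le
  calc s * |sinh (s * v)| ≤ 1 * |sinh (s * v)| :=
        mul_le_mul_of_nonneg_right hs.2 (abs_nonneg _)
    _ ≤ _ := by rw [one_mul]; exact h1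

/-- The smooth part `log (sinh (u / 2) / (u / 2))` of the kernel `log |exp t - exp x|`. -/
noncomputable def ker (u : ℝ) : ℝ := Real.log (sinhcEven 0 (u / 2))

/-- First derivative of `ker`. -/
noncomputable def ker₁ (u : ℝ) : ℝ := sinhcOdd 1 (u / 2) / (2 * sinhcEven 0 (u / 2))

/-- Second derivative of `ker`. -/
noncomputable def ker₂ (u : ℝ) : ℝ :=
  (sinhcEven 2 (u / 2) * sinhcEven 0 (u / 2) - sinhcOdd 1 (u / 2) ^ 2)
    / (4 * sinhcEven 0 (u / 2) ^ 2)

/-- Third derivative of `ker`. -/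
noncomputable def ker₃ (u : ℝ) : ℝ :=
  ((sinhcOdd 3 (u / 2) * sinhcEven 0 (u / 2) - sinhcEven 2 (u / 2) * sinhcOdd 1 (u / 2))
      * sinhcEven 0 (u / 2)
    - 2 * (sinhcEven 2 (u / 2) * sinhcEven 0 (u / 2) - sinhcOdd 1 (u / 2) ^ 2)
      * sinhcOdd 1 (u / 2)) / (8 * sinhcEven 0 (u / 2) ^ 3)

lemma sinhcEven_zero_ne (v : ℝ) : sinhcEven 0 v ≠ 0 :=
  (zero_lt_one.trans_le (one_le_sinhcEven_zero v)).ne'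

lemma hasDerivAt_half_comp {f f' : ℝ → ℝ} (h : ∀ v, HasDerivAt f (f' v) v) (u : ℝ) :
    HasDerivAt (fun u => f (u / 2)) (f' (u / 2) / 2) u := by
  have := (h (u / 2)).comp u ((hasDerivAt_id u).div_const 2)
  refine this.congr_deriv ?_
  ring

lemma hasDerivAt_ker (u : ℝ) : HasDerivAt ker (ker₁ u) u := by
  refine ((hasDerivAt_half_comp (hasDerivAt_sinhcEven 0) u).log (sinhcEven_zero_ne _)).congr_deriv ?_
  unfold ker₁
  have := sinhcEven_zero_ne (u / 2)
  field_simp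

lemma hasDerivAt_ker₁ (u : ℝ) : HasDerivAt ker₁ (ker₂ u) u := by
  have hne := sinhcEven_zero_ne (u / 2)
  refine ((hasDerivAt_half_comp (hasDerivAt_sinhcOdd 1) u).div
    ((hasDerivAt_half_comp (hasDerivAt_sinhcEven 0) u).const_mul 2) (by simpa)).congr_deriv ?_
  unfold ker₂
  field_simp
  ring

lemma hasDerivAt_ker₂ (u : ℝ) : HasDerivAt ker₂ (ker₃ u) u := by
  have hne := sinhcEven_zero_ne (u / 2)
  have h0 := hasDerivAt_half_comp (hasDerivAt_sinhcEven 0) u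
  have h1 := hasDerivAt_half_comp (hasDerivAt_sinhcOdd 1) u
  have h2 := hasDerivAt_half_comp (hasDerivAt_sinhcEven 2) u
  refine (((h2.mul h0).sub (h1.pow 2)).div ((h0.pow 2).const_mul 4) (by simpa)).congr_deriv ?_
  unfold ker₃
  simp only [Pi.mul_apply, Pi.pow_apply, Pi.sub_apply]
  field_simp
  ring

lemma continuous_ker : Continuous ker :=
  continuous_iff_continuousAt.2 fun u => (hasDerivAt_ker u).continuousAt

lemma continuous_ker₁ : Continuous ker₁ :=
  continuous_iff_continuousAt.2 fun u => (hasDerivAt_ker₁ u).continuousAt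

lemma continuous_ker₂ : Continuous ker₂ :=
  continuous_iff_continuousAt.2 fun u => (hasDerivAt_ker₂ u).continuousAt

lemma continuous_ker₃ : Continuous ker₃ := by
  have h0 := continuous_sinhcEven 0
  have h1 := continuous_sinhcOdd 1
  have h2 := continuous_sinhcEven 2
  have h3 := continuous_sinhcOdd 3
  unfold ker₃
  refine Continuous.div (by fun_prop) (by fun_prop) fun u => ?_
  have := sinhcEven_zero_ne (u / 2)
  positivity

lemma ker_neg (u : ℝ) : ker (-u) = ker u := by
  rw [ker, neg_div, sinhcEven_neg, ker]

lemma ker₂_nonneg (u : ℝ) : 0 ≤ ker₂ u :=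
  div_nonneg (sinhc_logConvex _) (by positivity)

lemma sq_mul_ker₂_le (u : ℝ) : u ^ 2 * ker₂ u ≤ 2 := by
  have h := sq_mul_sinhc_identity (u / 2)
  have h1 := one_le_sinhcEven_zero (u / 2)
  unfold ker₂
  rw [← mul_div_assoc, div_le_iff₀ (by positivity)]
  nlinarith

lemma abs_ker₁_le (u : ℝ) : |ker₁ u| ≤ 1 := by
  have h1 := one_le_sinhcEven_zero (u / 2)
  have h2 := abs_sinhcOdd_le (u / 2)
  unfold ker₁
  rw [abs_div, abs_of_pos (by positivity : 0 < 2 * sinhcEven 0 (u / 2)),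
    div_le_one (by positivity)]
  linarith

lemma log_exp_sub_exp {t x : ℝ} (h : t ≠ x) :
    Real.log |exp t - exp x| = (t + x) / 2 + Real.log |t - x| + ker (t - x) := by
  have h1 := mul_sinhcEven_zero ((t - x) / 2)
  have h2 : exp t - exp x = exp ((t + x) / 2) * ((t - x) * sinhcEven 0 ((t - x) / 2)) := by
    have : (t - x) * sinhcEven 0 ((t - x) / 2) = exp ((t - x) / 2) - exp (-((t - x) / 2)) := by
      rw [sinh_eq] at h1; linarith
    rw [this, mul_sub, ← exp_add, ← exp_add]
    congr 2 <;> ring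
  rw [h2, log_abs, log_abs, log_mul (exp_pos _).ne'
    (mul_ne_zero (sub_ne_zero.2 h) (sinhcEven_zero_ne _)), log_exp,
    log_mul (sub_ne_zero.2 h) (sinhcEven_zero_ne _), ker]
  ring

lemma admissible_ker (l : ℝ) : Admissible (fun u => ker (l * u)) (fun u => l * ker₁ (l * u))
    (fun u => l ^ 2 * ker₂ (l * u)) where
  hasDeriv u := by
    have := (hasDerivAt_ker (l * u)).comp u ((hasDerivAt_id u).const_mul l)
    refine this.congr_deriv ?_
    simp; ring
  hasDeriv₁ u := by
    have := ((hasDerivAt_ker₁ (l * u)).comp u ((hasDerivAt_id u).const_mul l)).const_mul l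
    refine this.congr_deriv ?_
    simp; ring
  cont₂ := by have := continuous_ker₂; fun_prop
  even u := by rw [mul_neg, ker_neg]
  nonneg₂ u := mul_nonneg (sq_nonneg _) (ker₂_nonneg _)
  bound₂ u := by
    have := sq_mul_ker₂_le (l * u)
    rw [mul_pow] at this
    linarith

lemma isUnit_of_locally_bounded_inverse {A : Type*} [NormedRing A] [HasSummableGeomSeries A]
    {f : ℝ → A} (hf : Continuous f) (h0 : IsUnit (f 0))
    (hb : ∀ R : ℝ, ∃ C : ℝ, 0 < C ∧ ∀ l, |l| ≤ R → ∀ u : Aˣ, ↑u = f l → ‖(↑u⁻¹ : A)‖ ≤ C) (l : ℝ) :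
    IsUnit (f l) := by
  have hopen : IsOpen {l | IsUnit (f l)} := Units.isOpen.preimage hf
  have hclosed : IsClosed {l | IsUnit (f l)} := by
    refine isClosed_of_closure_subset fun x hx => ?_
    obtain ⟨C, hC, hbC⟩ := hb (|x| + 1)
    obtain ⟨δ, hδ, hfδ⟩ := Metric.continuous_iff.1 hf x (C⁻¹ / 2) (by positivity)
    obtain ⟨z, hz, hzx⟩ := Metric.mem_closure_iff.1 hx (min δ 1) (by positivity)
    obtain ⟨u, hu⟩ := hz
    rw [dist_comm] at hzx
    have h1 := hfδ z (hzx.trans_le (min_le_left _ _))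
    have h2 := hzx.trans_le (min_le_right _ _)
    have h3 : ‖(↑u⁻¹ : A)‖ ≤ C := hbC z (by
      rw [Real.dist_eq] at h2
      have := abs_sub_abs_le_abs_sub z x
      linarith) u hu
    rcases subsingleton_or_nontrivial A with hA | hA
    · exact isUnit_of_subsingleton _
    have h4 : 0 < ‖(↑u⁻¹ : A)‖ := norm_pos_iff.2 (Units.ne_zero _)
    have h5 : C⁻¹ ≤ ‖(↑u⁻¹ : A)‖⁻¹ := inv_anti₀ h4 h3
    have h6 : 0 < C⁻¹ := by positivity
    refine ⟨u.ofNearby (f x) ?_, rfl⟩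
    rw [hu, ← dist_eq_norm, dist_comm]
    linarith
  have := IsClopen.eq_univ ⟨hclosed, hopen⟩ ⟨0, h0⟩
  exact (this ▸ mem_univ l : l ∈ {l | IsUnit (f l)})

lemma continuous_inverse {A X : Type*} [NormedRing A] [HasSummableGeomSeries A]
    [TopologicalSpace X] {T : X → A} (hT : Continuous T) (hu : ∀ x, IsUnit (T x)) :
    Continuous fun x => Ring.inverse (T x) := continuous_iff_continuousAt.2 fun x => by
  obtain ⟨u, hu⟩ := hu x
  have := NormedRing.inverse_continuousAt u
  rw [hu] at this
  exact ContinuousAt.comp (f := T) this hT.continuousAt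

/-- Constant extension to the line of a continuous function on `[-1, 1]`. -/
noncomputable def extend (φ : C(Icc (-1 : ℝ) 1, ℝ)) : ℝ → ℝ := IccExtend (by norm_num) φ

lemma continuous_extend (φ : C(Icc (-1 : ℝ) 1, ℝ)) : Continuous (extend φ) :=
  φ.continuous.Icc_extend'

lemma extend_of_mem (φ : C(Icc (-1 : ℝ) 1, ℝ)) {y : ℝ} (hy : y ∈ Icc (-1 : ℝ) 1) :
    extend φ y = φ ⟨y, hy⟩ := IccExtend_of_mem _ _ hy

lemma abs_extend_le (φ : C(Icc (-1 : ℝ) 1, ℝ)) (y : ℝ) : |extend φ y| ≤ ‖φ‖ :=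
  φ.norm_coe_le_norm _

lemma extend_add (φ χ : C(Icc (-1 : ℝ) 1, ℝ)) (y : ℝ) :
    extend (φ + χ) y = extend φ y + extend χ y := rfl

lemma extend_smul (c : ℝ) (φ : C(Icc (-1 : ℝ) 1, ℝ)) (y : ℝ) :
    extend (c • φ) y = c * extend φ y := rfl

/-- `chebInv` as a bounded operator on `C([-1, 1])`. -/
noncomputable def chebInvCLM : C(Icc (-1 : ℝ) 1, ℝ) →L[ℝ] C(Icc (-1 : ℝ) 1, ℝ) :=
  LinearMap.mkContinuous
    { toFun := fun φ => ⟨fun y => chebInv (extend φ) y,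
        (continuous_chebInv (continuous_extend φ)).comp continuous_subtype_val⟩
      map_add' := fun φ χ => by
        ext y
        exact chebInv_add (continuous_extend φ) (continuous_extend χ) y
      map_smul' := fun c φ => by
        ext y
        exact chebInv_const_mul (extend φ) c y } 1 fun φ => by
    rw [one_mul, ContinuousMap.norm_le _ (norm_nonneg _)]
    exact fun y => abs_chebInv_le (fun t _ => abs_extend_le φ t) y.2

lemma extend_chebInvCLM (φ : C(Icc (-1 : ℝ) 1, ℝ)) {y : ℝ} (hy : y ∈ Icc (-1 : ℝ) 1) :
    extend (chebInvCLM φ) y = chebInv (extend φ) y := by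
  rw [extend_of_mem _ hy]; rfl

/-- The scaled second derivative kernel as a continuous function of two variables. -/
noncomputable def kernelCurve : C(ℝ, C(Icc (-1 : ℝ) 1 × Icc (-1 : ℝ) 1, ℝ)) :=
  ContinuousMap.curry ⟨fun p => p.1 ^ 2 * ker₂ (p.1 * (p.2.1 - p.2.2)), by
    have := continuous_ker₂
    fun_prop⟩

/-- Integral operators on `C([-1, 1])` with continuous kernel. -/
noncomputable def integralCLM : C(Icc (-1 : ℝ) 1 × Icc (-1 : ℝ) 1, ℝ) →L[ℝ]
    C(Icc (-1 : ℝ) 1, ℝ) →L[ℝ] C(Icc (-1 : ℝ) 1, ℝ) :=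
  LinearMap.mkContinuous₂
    (LinearMap.mk₂ ℝ
      (fun K φ => ⟨fun y => ∫ t in (-1 : ℝ)..1,
          K (y, projIcc (-1) 1 (by norm_num) t) * extend φ t, by
        have hφ := continuous_extend φ
        have hp : Continuous (projIcc (-1 : ℝ) 1 (by norm_num)) := continuous_projIcc
        exact intervalIntegral.continuous_parametric_intervalIntegral_of_continuous'
          (by fun_prop) _ _⟩)
      (fun K K' φ => by
        ext y
        have hφ := continuous_extend φ
        have hp : Continuous (projIcc (-1 : ℝ) 1 (by norm_num)) := continuous_projIcc
        simp only [ContinuousMap.coe_mk, ContinuousMap.add_apply, add_mul]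
        exact intervalIntegral.integral_add ((by fun_prop : Continuous _).intervalIntegrable _ _)
          ((by fun_prop : Continuous _).intervalIntegrable _ _))
      (fun c K φ => by
        ext y
        simp only [ContinuousMap.coe_mk, ContinuousMap.smul_apply, smul_eq_mul, mul_assoc]
        exact intervalIntegral.integral_const_mul _ _)
      (fun K φ χ => by
        ext y
        have hφ := continuous_extend φ
        have hχ := continuous_extend χ
        have hp : Continuous (projIcc (-1 : ℝ) 1 (by norm_num)) := continuous_projIcc
        simp only [ContinuousMap.coe_mk, ContinuousMap.add_apply, extend_add, mul_add]
        exact intervalIntegral.integral_add ((by fun_prop : Continuous _).intervalIntegrable _ _)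
          ((by fun_prop : Continuous _).intervalIntegrable _ _))
      (fun c K φ => by
        ext y
        simp only [ContinuousMap.coe_mk, ContinuousMap.smul_apply, smul_eq_mul, extend_smul,
          mul_left_comm _ c]
        exact intervalIntegral.integral_const_mul _ _))
    2 fun K φ => by
      rw [ContinuousMap.norm_le _ (by positivity)]
      intro y
      have := intervalIntegral.norm_integral_le_of_norm_le_const (a := -1) (b := 1)
        (C := ‖K‖ * ‖φ‖)
        (f := fun t => K (y, projIcc (-1) 1 (by norm_num) t) * extend φ t) fun t _ => by
          rw [norm_mul]
          exact mul_le_mul (K.norm_coe_le_norm _) (abs_extend_le φ t) (norm_nonneg _)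
            (norm_nonneg _)
      refine this.trans (le_of_eq ?_)
      norm_num; ring

lemma extend_integralCLM (l : ℝ) (φ : C(Icc (-1 : ℝ) 1, ℝ)) {y : ℝ} (hy : y ∈ Icc (-1 : ℝ) 1) :
    extend (integralCLM (kernelCurve l) φ) y
      = conv (fun u => l ^ 2 * ker₂ (l * u)) (extend φ) y := by
  rw [extend_of_mem _ hy]
  refine intervalIntegral.integral_congr fun t ht => ?_
  rw [uIcc_of_le (by norm_num)] at ht
  simp [kernelCurve, projIcc_of_mem _ ht]

/-- Scaled sup bound for solutions of the linearized equation. -/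
lemma norm_le_of_fixed {M : ℝ} (hM0 : 0 ≤ M) (hM : ∀ u, ker₂ u ≤ M) {R l : ℝ} (hl : |l| ≤ R)
    (φ : C(Icc (-1 : ℝ) 1, ℝ)) :
    ‖φ‖ ≤ (1 + R ^ 2 * M) * ‖φ + chebInvCLM (integralCLM (kernelCurve l) φ)‖ := by
  set r := φ + chebInvCLM (integralCLM (kernelCurve l) φ) with hr
  set χ := φ + (-1 : ℝ) • r with hχ
  have hG := admissible_ker l
  set G : ℝ → ℝ := fun u => ker (l * u)
  set G₁ : ℝ → ℝ := fun u => l * ker₁ (l * u)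
  set G₂ : ℝ → ℝ := fun u => l ^ 2 * ker₂ (l * u) with hG₂
  have hfix : ∀ y ∈ Icc (-1 : ℝ) 1,
      extend χ y = chebInv (fun y => 0 - conv G₂ (extend φ) y) y := fun y hy => by
    have h1 : extend χ y = -1 * extend (chebInvCLM (integralCLM (kernelCurve l) φ)) y := by
      rw [hχ, hr, extend_add, extend_smul, extend_add]; ring
    rw [h1, extend_chebInvCLM _ hy, ← chebInv_const_mul]
    refine chebInv_congr (fun t ht => ?_) hy
    have := extend_integralCLM l φ ht
    change -1 * extend (integralCLM (kernelCurve l) φ) t = 0 - conv G₂ (extend φ) t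
    rw [this]; ring
  obtain ⟨A, hA⟩ := potential_add_eq_affine (H := fun _ => 0) (H₁ := fun _ => 0)
    (H₂ := fun _ => 0) hG (fun x => hasDerivAt_const x 0) (fun x => hasDerivAt_const x 0)
    continuous_const (continuous_extend χ) (continuous_extend φ) hfix
  have hconv : ∀ y, 0 + conv G (extend χ) y - conv G (extend φ) y
      = -1 * conv G (extend r) y := fun y => by
    have hi : ∀ ψ : C(Icc (-1 : ℝ) 1, ℝ), IntervalIntegrable (fun t => G (y - t) * extend ψ t)
        volume (-1) 1 := fun ψ => by
      have := hG.continuous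
      have := continuous_extend ψ
      exact (by fun_prop : Continuous _).intervalIntegrable _ _
    unfold conv
    rw [hχ]
    simp only [extend_add, extend_smul, mul_add, mul_left_comm _ (-1 : ℝ)]
    rw [intervalIntegral.integral_add (hi _) ((hi _).const_mul _),
      intervalIntegral.integral_const_mul]
    ring
  obtain ⟨A', B', hw⟩ := barrier hG
  have hwc : Continuous fun t : ℝ => √(1 - t ^ 2) := by fun_prop
  set K := R ^ 2 * M * ‖r‖ with hK
  have hR2 : l ^ 2 ≤ R ^ 2 := sq_le_sq' (abs_le.1 hl).1 (abs_le.1 hl).2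
  have hconvb : ∀ y, |conv G₂ (extend r) y| ≤ 2 * K := fun y => by
    have := intervalIntegral.norm_integral_le_of_norm_le_const (a := -1) (b := 1)
        (C := K) (f := fun t => G₂ (y - t) * extend r t) fun t _ => by
          rw [norm_mul, Real.norm_eq_abs, Real.norm_eq_abs, abs_of_nonneg (hG.nonneg₂ _)]
          refine mul_le_mul (mul_le_mul hR2 (hM _) (ker₂_nonneg _) (sq_nonneg _))
            (abs_extend_le r t) (abs_nonneg _) (by positivity)
    refine this.trans (le_of_eq ?_)
    norm_num; ring
  have hK0 : 0 ≤ K := by positivity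
  have hpi := pi_gt_three
  have hdiff : ∀ y ∈ Ioo (-1 : ℝ) 1, DifferentiableAt ℝ (extend χ) y := fun y hy => by
    have hd := differentiableAt_chebInv (v := fun y => 0 - conv G₂ (extend φ) y)
      (v' := fun y => 0 - conv (fun u => l ^ 2 * (l * ker₃ (l * u))) (extend φ) y) (fun x => by
        refine (hasDerivAt_const x 0).sub (hasDerivAt_conv (fun u => ?_) ?_ (continuous_extend φ) x)
        · have := ((hasDerivAt_ker₂ (l * u)).comp u ((hasDerivAt_id u).const_mul l)).const_mul
            (l ^ 2)
          exact this.congr_deriv (by ring)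
        · have := continuous_ker₃
          fun_prop)
      (by
        refine continuous_const.sub (continuous_conv ?_ (continuous_extend φ))
        have := continuous_ker₃
        fun_prop) hy
    refine hd.congr_of_eventuallyEq ?_
    filter_upwards [Icc_mem_nhds hy.1 hy.2] with z hz using hfix z hz
  have key : ∀ σ : ℝ, |σ| ≤ 1 → ∀ y ∈ Icc (-1 : ℝ) 1,
      0 ≤ K * √(1 - y ^ 2) + σ * extend χ y := fun σ hσ => by
    have hcχ := continuous_extend χ
    refine nonneg_of_convex (φ := fun y => K * √(1 - y ^ 2) + σ * extend χ y)
      (f := fun y => K * (π * y ^ 2 + conv G (fun t => √(1 - t ^ 2)) y)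
        + (-σ) * conv G (extend r) y) (A := K * A' + σ * A)
      (B := K * B' + σ * (1 / π * (∫ α in (0 : ℝ)..π, (0 - conv G₁ (extend φ) (cos α))))) hG
      (by fun_prop) (fun y hy => ?_) ?_ ?_ (fun x h _ _ _ => ?_) (fun y hy => ?_)
    · refine DifferentiableAt.add ?_ ((hdiff y hy).const_mul _)
      refine DifferentiableAt.const_mul (DifferentiableAt.sqrt (by fun_prop) ?_) _
      have := hy.1; have := hy.2
      nlinarith
    · simp [hfix (-1) (by norm_num), chebInv_neg_one]
    · simp [hfix 1 (by norm_num), chebInv_one]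
    · rw [secondDiff_add, secondDiff_const_mul, secondDiff_const_mul]
      have e1 := mul_le_mul_of_nonneg_left (secondDiff_barrier_ge hG x h) hK0
      have d1 := hasDerivAt_conv hG.hasDeriv hG.continuous₁ (continuous_extend r)
      have d2 := hasDerivAt_conv hG.hasDeriv₁ hG.cont₂ (continuous_extend r)
      have e2 := secondDiff_le d1 d2 (fun x => (abs_le.1 (hconvb x)).2) x h
      have e3 := secondDiff_ge d1 d2 (fun x => (abs_le.1 (hconvb x)).1) x h
      have e4 : |secondDiff (conv G (extend r)) x h| ≤ 2 * K * h ^ 2 := by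
        rw [abs_le]; constructor <;> linarith
      have e5 : |(-σ) * secondDiff (conv G (extend r)) x h| ≤ 2 * K * h ^ 2 := by
        rw [abs_mul, abs_neg]
        exact (mul_le_of_le_one_left (abs_nonneg _) hσ).trans e4
      have e6 := (abs_le.1 e5).1
      have e7 : 0 ≤ K * h ^ 2 := by positivity
      nlinarith
    · have hc1 : Continuous fun t : ℝ => K * √(1 - t ^ 2) := by fun_prop
      have hc2 : Continuous fun t : ℝ => σ * extend χ t := by fun_prop
      rw [potential_add hG.continuous hc1.continuousOn hc2.continuousOn, potential_const_mul,
        potential_const_mul]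
      have e1 := hw y hy
      have e2 := hA y hy
      rw [hconv] at e2
      linear_combination K * e1 + σ * e2
  have hχb : ∀ y ∈ Icc (-1 : ℝ) 1, |extend χ y| ≤ K := fun y hy => by
    have h1 := key 1 (by norm_num) y hy
    have h2 := key (-1) (by norm_num) y hy
    have hs : √(1 - y ^ 2) ≤ 1 := by rw [sqrt_le_one]; nlinarith [sq_nonneg y]
    have : K * √(1 - y ^ 2) ≤ K := mul_le_of_le_one_right hK0 hs
    rw [abs_le]; constructor <;> linarith
  have hrn := norm_nonneg r
  rw [ContinuousMap.norm_le _ (by positivity)]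
  intro y
  have h1 := hχb y y.2
  have h2 := abs_extend_le r y
  have h3 : φ y = extend χ y + extend r y := by
    rw [hχ, extend_add, extend_smul, extend_of_mem φ y.2]; ring
  rw [h3, Real.norm_eq_abs]
  refine (abs_add_le _ _).trans ?_
  rw [hK] at h1
  linarith

lemma isUnit_one_add (l : ℝ) : IsUnit
    (1 + chebInvCLM ∘L integralCLM (kernelCurve l) :
      C(Icc (-1 : ℝ) 1, ℝ) →L[ℝ] C(Icc (-1 : ℝ) 1, ℝ)) := by
  refine isUnit_of_locally_bounded_inverse
    (f := fun l => 1 + chebInvCLM ∘L integralCLM (kernelCurve l)) ?_ ?_ (fun R => ?_) l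
  · have := kernelCurve.continuous
    fun_prop
  · have : kernelCurve 0 = 0 := by ext p; simp [kernelCurve]
    simp [this]
  · obtain ⟨M, hM0, hM⟩ := (admissible_ker 1).exists_bound
    have hM' : ∀ u, ker₂ u ≤ M := fun u => by simpa using hM u
    refine ⟨1 + R ^ 2 * M, by positivity, fun l hl u hu => ?_⟩
    refine ContinuousLinearMap.opNorm_le_bound _ (by positivity) fun x => ?_
    have h1 := norm_le_of_fixed hM0 hM' hl ((↑u⁻¹ : C(Icc (-1 : ℝ) 1, ℝ) →L[ℝ] _) x)
    have h2 : (↑u : C(Icc (-1 : ℝ) 1, ℝ) →L[ℝ] _) ((↑u⁻¹ : C(Icc (-1 : ℝ) 1, ℝ) →L[ℝ] _) x) = x := by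
      have := u.mul_inv
      exact congrArg (fun (F : C(Icc (-1 : ℝ) 1, ℝ) →L[ℝ] C(Icc (-1 : ℝ) 1, ℝ)) => F x) this
    rw [hu] at h2
    change _ + chebInvCLM _ = x at h2
    rwa [show (↑u⁻¹ : C(Icc (-1 : ℝ) 1, ℝ) →L[ℝ] _) x + chebInvCLM (integralCLM (kernelCurve l)
      ((↑u⁻¹ : C(Icc (-1 : ℝ) 1, ℝ) →L[ℝ] _) x)) = x from h2] at h1

/-- Solvability of the fixed point equation, with continuous dependence on the parameters. -/
lemma exists_solution {W : ℝ → ℝ} (hW : Continuous W) : ∃ φ : ℝ → ℝ → ℝ → ℝ,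
    Continuous (fun p : ℝ × ℝ × ℝ => φ p.1 p.2.1 p.2.2) ∧
    ∀ m l, ∀ y ∈ Icc (-1 : ℝ) 1, φ m l y = chebInv (fun y => l * W (m + l * y)
      - conv (fun u => l ^ 2 * ker₂ (l * u)) (φ m l) y) y := by
  let F : C(ℝ × ℝ, C(Icc (-1 : ℝ) 1, ℝ)) :=
    ContinuousMap.curry ⟨fun p => p.1.2 * W (p.1.1 + p.1.2 * p.2), by fun_prop⟩
  let T : ℝ → C(Icc (-1 : ℝ) 1, ℝ) →L[ℝ] C(Icc (-1 : ℝ) 1, ℝ) :=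
    fun l => 1 + chebInvCLM ∘L integralCLM (kernelCurve l)
  have hT : Continuous T := by
    have := kernelCurve.continuous
    fun_prop
  let Φ : ℝ × ℝ → C(Icc (-1 : ℝ) 1, ℝ) := fun p => Ring.inverse (T p.2) (chebInvCLM (F p))
  have hinv : Continuous fun l => Ring.inverse (T l) :=
    continuous_inverse (A := C(Icc (-1 : ℝ) 1, ℝ) →L[ℝ] C(Icc (-1 : ℝ) 1, ℝ)) hT isUnit_one_add
  have hΦ : Continuous Φ := by
    have := F.continuous
    have h2 : Continuous fun p : ℝ × ℝ => Ring.inverse (T p.2) := hinv.comp continuous_snd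
    fun_prop
  refine ⟨fun m l => extend (Φ (m, l)), ?_, fun m l y hy => ?_⟩
  · have hp : Continuous (projIcc (-1 : ℝ) 1 (by norm_num)) := continuous_projIcc
    change Continuous fun p : ℝ × ℝ × ℝ => (Φ (p.1, p.2.1)) (projIcc (-1) 1 (by norm_num) p.2.2)
    fun_prop
  · have h1 : T l (Φ (m, l)) = chebInvCLM (F (m, l)) := by
      have := Ring.mul_inverse_cancel (T l) (isUnit_one_add l)
      exact congrArg (fun (A : C(Icc (-1 : ℝ) 1, ℝ) →L[ℝ] C(Icc (-1 : ℝ) 1, ℝ)) =>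
        A (chebInvCLM (F (m, l)))) this
    have h2 : Φ (m, l) + chebInvCLM (integralCLM (kernelCurve l) (Φ (m, l)))
        = chebInvCLM (F (m, l)) := h1
    have h3 : Φ (m, l) = chebInvCLM (F (m, l)
        + (-1 : ℝ) • integralCLM (kernelCurve l) (Φ (m, l))) := by
      rw [map_add, map_smul, ← h2]; simp
    have h4 := congrArg (fun φ => extend φ y) h3
    refine h4.trans ?_
    rw [ extend_chebInvCLM _ hy]
    refine chebInv_congr (fun t ht => ?_) hy
    rw [extend_add, extend_smul, extend_integralCLM _ _ ht, extend_of_mem _ ht]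
    simp [F]; ring

lemma eventually_secondDiff_potential_ge {G G₁ G₂ φ : ℝ → ℝ} (hG : Admissible G G₁ G₂)
    (hφ : Continuous φ) (h0 : ∀ t ∈ Icc (-1 : ℝ) 1, 0 ≤ φ t) {x : ℝ} (hx : φ x = 0) {η : ℝ}
    (hη : 0 < η) : ∀ᶠ h in 𝓝[>] (0 : ℝ), -(η * h) ≤ secondDiff (potential G φ) x h := by
  obtain ⟨M, hM0, hM⟩ := hG.exists_bound
  have hδ : 0 < η / (8 + 2 * M) := by positivity
  obtain ⟨r, hr, hr'⟩ := Metric.continuous_iff.1 hφ x _ hδ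
  filter_upwards [Ioo_mem_nhdsGT (show (0 : ℝ) < min r 1 by positivity)] with h hh
  have h1 : h < r := hh.2.trans_le (min_le_left _ _)
  have h2 : h ≤ 1 := (hh.2.trans_le (min_le_right _ _)).le
  have := secondDiff_potential_ge hG hφ.continuousOn hM0 hM h0 hh.1 h2 hδ.le (x := x)
    fun t _ hxt => by
      have := hr' t (by rw [Real.dist_eq, abs_sub_comm]; linarith)
      rw [hx, Real.dist_eq, sub_zero] at this
      exact (le_abs_self _).trans this.le
  refine le_trans (le_of_eq ?_) this
  have : (8 : ℝ) + 2 * M ≠ 0 := by positivity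
  field_simp

lemma potential_comp_neg {G G₁ G₂ : ℝ → ℝ} (hG : Admissible G G₁ G₂) (φ : ℝ → ℝ) (y : ℝ) :
    potential G (fun t => φ (-t)) y = potential G φ (-y) := by
  unfold potential
  have := intervalIntegral.integral_comp_neg (a := -1) (b := 1)
    (fun t => logKer G (-y - t) * φ t)
  rw [neg_neg] at this
  rw [← this]
  refine intervalIntegral.integral_congr fun t _ => ?_
  change logKer G (y - t) * φ (-t) = logKer G (-y - -t) * φ (-t)
  rw [show -y - -t = -(y - t) by ring, hG.logKer_even]

/-- The potential of a positive density decreases to the right of the support. -/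
lemma potential_le_one {G G₁ G₂ φ : ℝ → ℝ} (hG : Admissible G G₁ G₂)
    (hφ : ContinuousOn φ (Icc (-1) 1)) (h0 : ∀ t ∈ Icc (-1 : ℝ) 1, 0 ≤ φ t) {y : ℝ} (hy : 1 ≤ y) :
    potential G φ y ≤ potential G φ 1 := by
  have hφ' : ContinuousOn φ (uIcc (-1 : ℝ) 1) := by rwa [uIcc_of_le (by norm_num)]
  refine intervalIntegral.integral_mono_on_of_le_Ioo (by norm_num)
    (intervalIntegrable_logKer hG.continuous hφ' y) (intervalIntegrable_logKer hG.continuous hφ' 1)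
    fun t ht => ?_
  refine mul_le_mul_of_nonneg_right ?_ (h0 t ⟨ht.1.le, ht.2.le⟩)
  have h1 : 0 < 1 - t := by linarith [ht.2]
  refine hG.logKer_le_of_abs_le h1.ne' ?_
  rw [abs_of_pos h1, abs_of_pos (by linarith)]
  linarith

/-- Balance of forces at the right endpoint. -/
lemma slope_le_deriv {G G₁ G₂ φ F : ℝ → ℝ} (hG : Admissible G G₁ G₂)
    (hφ : Continuous φ) (h0 : ∀ t ∈ Icc (-1 : ℝ) 1, 0 ≤ φ t) (h1 : φ 1 = 0) {f A B : ℝ}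
    (hF : HasDerivAt F f 1)
    (heq : ∀ y ∈ Icc (-1 : ℝ) 1, potential G φ y + F y = A + B * y) : B ≤ f := by
  refine le_of_forall_pos_le_add fun η hη => ?_
  have hlim : Tendsto (fun h => (F (1 - h) - F 1) / (-h)) (𝓝[>] (0 : ℝ)) (𝓝 f) := by
    have h2 : Tendsto (fun h : ℝ => 1 - h) (𝓝[>] 0) (𝓝[≠] 1) := by
      refine tendsto_nhdsWithin_iff.2 ⟨?_, ?_⟩
      · have : Tendsto (fun h : ℝ => 1 - h) (𝓝 0) (𝓝 (1 - 0)) := by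
          exact (by fun_prop : Continuous fun h : ℝ => 1 - h).tendsto 0
        rw [sub_zero] at this
        exact this.mono_left nhdsWithin_le_nhds
      · filter_upwards [self_mem_nhdsWithin] with h hh
        have : (0 : ℝ) < h := hh
        simp [this.ne']
    refine (hF.tendsto_slope.comp h2).congr fun h => ?_
    simp only [Function.comp, slope_def_field]
    congr 1; ring
  refine le_of_tendsto_of_tendsto (tendsto_const_nhds (x := B)) (hlim.add_const η) ?_
  filter_upwards [eventually_secondDiff_potential_ge hG hφ h0 h1 hη,
    Ioo_mem_nhdsGT (show (0 : ℝ) < 1 by norm_num)] with h hh hh1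
  have e1 := heq 1 (by norm_num)
  have e2 := heq (1 - h) ⟨by linarith [hh1.2], by linarith [hh1.1]⟩
  have e3 := potential_le_one hG hφ.continuousOn h0 (show 1 ≤ 1 + h by linarith [hh1.1])
  unfold secondDiff at hh
  have hpos := hh1.1
  have : B - η ≤ (F (1 - h) - F 1) / (-h) := by
    rw [div_neg, ← neg_div, le_div_iff₀ hpos]
    nlinarith
  linarith

lemma convexOn_potential {G G₁ G₂ φ : ℝ → ℝ} (hG : Admissible G G₁ G₂)
    (hφ : ContinuousOn φ (Icc (-1) 1)) (h0 : ∀ t ∈ Icc (-1 : ℝ) 1, 0 ≤ φ t) :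
    ConvexOn ℝ (Ici 1) (potential G φ) := by
  have hφ' : ContinuousOn φ (uIcc (-1 : ℝ) 1) := by rwa [uIcc_of_le (by norm_num)]
  have hi := intervalIntegrable_logKer hG.continuous hφ'
  refine ⟨convex_Ici 1, fun x hx y hy p q hp hq hpq => ?_⟩
  simp only [smul_eq_mul]
  unfold potential
  rw [← intervalIntegral.integral_const_mul, ← intervalIntegral.integral_const_mul,
    ← intervalIntegral.integral_add ((hi x).const_mul p) ((hi y).const_mul q)]
  refine intervalIntegral.integral_mono_on_of_le_Ioo (by norm_num) (hi _)
    (((hi x).const_mul p).add ((hi y).const_mul q)) fun t ht => ?_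
  have hx' : x - t ∈ Ioi (0 : ℝ) := sub_pos.2 (ht.2.trans_le hx)
  have hy' : y - t ∈ Ioi (0 : ℝ) := sub_pos.2 (ht.2.trans_le hy)
  have := hG.convexOn_logKer.2 hx' hy' hp hq hpq
  simp only [smul_eq_mul] at this
  have e : p * (x - t) + q * (y - t) = p * x + q * y - t := by linear_combination (-t) * hpq
  rw [e] at this
  have := mul_le_mul_of_nonneg_right this (h0 t ⟨ht.1.le, ht.2.le⟩)
  linarith

/-- Strict inequality to the right of the support. -/
lemma lt_potential_add_of_one_lt {G G₁ G₂ φ F F₁ F₂ : ℝ → ℝ} (hG : Admissible G G₁ G₂)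
    (hφ : Continuous φ) (h0 : ∀ t ∈ Icc (-1 : ℝ) 1, 0 ≤ φ t) (h1 : φ 1 = 0) {c A : ℝ} (hc : 0 < c)
    (hF : ∀ x, HasDerivAt F (F₁ x) x) (hF₁ : ∀ x, HasDerivAt F₁ (F₂ x) x) (hF₂ : ∀ x, c ≤ F₂ x)
    (heq : ∀ y ∈ Icc (-1 : ℝ) 1, potential G φ y + F y = A) {y : ℝ} (hy : 1 < y) :
    A < potential G φ y + F y := by
  by_contra! hle
  have hconv : ConvexOn ℝ univ fun x => F x - c / 2 * x ^ 2 := by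
    have d1 : ∀ x, HasDerivAt (fun x => F x - c / 2 * x ^ 2) (F₁ x - c * x) x := fun x =>
      ((hF x).sub ((hasDerivAt_pow 2 x).const_mul (c / 2))).congr_deriv (by norm_num; ring)
    have d2 : ∀ x, HasDerivAt (fun x => F₁ x - c * x) (F₂ x - c) x := fun x =>
      ((hF₁ x).sub ((hasDerivAt_id x).const_mul c)).congr_deriv (by ring)
    refine convexOn_univ_of_deriv2_nonneg (fun x => (d1 x).differentiableAt) ?_ fun x => ?_
    · rw [show deriv (fun x => F x - c / 2 * x ^ 2) = fun x => F₁ x - c * x from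
        funext fun x => (d1 x).deriv]
      exact fun x => (d2 x).differentiableAt
    · simp only [Function.iterate_succ, Function.iterate_zero, Function.comp, id]
      rw [show deriv (fun x => F x - c / 2 * x ^ 2) = fun x => F₁ x - c * x from
        funext fun x => (d1 x).deriv, (d2 x).deriv]
      linarith [hF₂ x]
  have hU := convexOn_potential hG hφ.continuousOn h0
  set d := y - 1 with hd
  have hdpos : 0 < d := by linarith
  have hη : 0 < c * d / 8 := by positivity
  obtain ⟨h, hh, hh1⟩ := ((eventually_secondDiff_potential_ge hG hφ h0 h1 hη).and
    (Ioo_mem_nhdsGT (show (0 : ℝ) < min 1 (d / 2) by positivity))).exists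
  have hpos : 0 < h := hh1.1
  have hlt1 : h < 1 := hh1.2.trans_le (min_le_left _ _)
  have hlt2 : h < d / 2 := hh1.2.trans_le (min_le_right _ _)
  set s := h / d with hs
  have hsd : s * d = h := by rw [hs]; field_simp
  have hs0 : 0 < s := by positivity
  have hs2 : s < 1 / 2 := by rw [hs, div_lt_iff₀ hdpos]; linarith
  have c1 := hU.2 (mem_Ici.2 le_rfl : (1 : ℝ) ∈ Ici 1) (mem_Ici.2 hy.le)
    (by linarith : 0 ≤ 1 - s) hs0.le (by ring)
  have c2 := hconv.2 (mem_univ 1) (mem_univ y) (by linarith : 0 ≤ 1 - s) hs0.le (by ring)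
  have e : (1 - s) * 1 + s * y = 1 + h := by rw [← hsd, hd]; ring
  simp only [smul_eq_mul, e] at c1 c2
  have e1 := heq 1 (by norm_num)
  have e2 := heq (1 - h) ⟨by linarith, by linarith⟩
  have e3 := secondDiff_ge hF hF₁ hF₂ 1 h
  unfold secondDiff at hh e3
  have hyd : y = 1 + d := by rw [hd]; ring
  have k1 : potential G φ (1 + h) + F (1 + h)
      ≤ A - s * (A - (potential G φ y + F y)) - c / 2 * (s * (1 - s) * d ^ 2) := by
    have : (1 - s) * (1 : ℝ) ^ 2 + s * y ^ 2 - (1 + h) ^ 2 = s * (1 - s) * d ^ 2 := by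
      rw [← hsd, hyd]; ring
    have hA : potential G φ 1 = A - F 1 := by linarith
    rw [hA] at c1
    linear_combination c1 + c2 - c / 2 * this
  have k2 : 0 ≤ s * (A - (potential G φ y + F y)) := mul_nonneg hs0.le (by linarith)
  have k3 : s * (1 - s) * d ^ 2 = h * ((1 - s) * d) := by rw [← hsd]; ring
  rw [k3] at k1
  have k4 : d / 2 ≤ (1 - s) * d := by nlinarith
  have k5 : h * (d / 2) ≤ h * ((1 - s) * d) := mul_le_mul_of_nonneg_left k4 hpos.le
  have k6 : 0 ≤ c * h ^ 2 := by positivity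
  have k7 : c / 2 * (h * (d / 2)) ≤ c / 2 * (h * ((1 - s) * d)) :=
    mul_le_mul_of_nonneg_left k5 (by positivity)
  have k8 : 0 < c * d * h := by positivity
  nlinarith

/-- A `C³` external field with second derivative bounded below. -/
structure ConvexField (c : ℝ) (V V₁ V₂ V₃ : ℝ → ℝ) : Prop where
  pos : 0 < c
  hasDeriv : ∀ x, HasDerivAt V (V₁ x) x
  hasDeriv₁ : ∀ x, HasDerivAt V₁ (V₂ x) x
  hasDeriv₂ : ∀ x, HasDerivAt V₂ (V₃ x) x
  cont₃ : Continuous V₃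
  le₂ : ∀ x, c ≤ V₂ x

/-- Solutions of the fixed point equation on the interval with center `m` and radius `l`. -/
structure IsDensity (V₂ : ℝ → ℝ) (m l : ℝ) (φ : ℝ → ℝ) : Prop where
  cont : Continuous φ
  fixed : ∀ y ∈ Icc (-1 : ℝ) 1, φ y = chebInv (fun y => l * V₂ (m + l * y)
    - conv (fun u => l ^ 2 * ker₂ (l * u)) φ y) y

/-- The slope of the effective potential on `[-1, 1]`. -/
noncomputable def slope (V₁ : ℝ → ℝ) (m l : ℝ) (φ : ℝ → ℝ) : ℝ :=
  1 / π * ∫ α in (0 : ℝ)..π, (V₁ (m + l * cos α) - conv (fun u => l * ker₁ (l * u)) φ (cos α))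

namespace ConvexField

variable {c : ℝ} {V V₁ V₂ V₃ : ℝ → ℝ}

lemma cont₁ (hV : ConvexField c V V₁ V₂ V₃) : Continuous V₁ := continuous_iff_continuousAt.2 fun x => (hV.hasDeriv₁ x).continuousAt

lemma cont₂ (hV : ConvexField c V V₁ V₂ V₃) : Continuous V₂ := continuous_iff_continuousAt.2 fun x => (hV.hasDeriv₂ x).continuousAt

lemma hasDerivAt_scaled (hV : ConvexField c V V₁ V₂ V₃) {l : ℝ} (hl : l ≠ 0) (m y : ℝ) :
    HasDerivAt (fun y => V (m + l * y) / l) (V₁ (m + l * y)) y := by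
  have h := ((hasDerivAt_id y).const_mul l).const_add m
  exact (((hV.hasDeriv (m + l * y)).comp y h).div_const l).congr_deriv (by field_simp)

lemma hasDerivAt_scaled₁ (hV : ConvexField c V V₁ V₂ V₃) (m l y : ℝ) :
    HasDerivAt (fun y => V₁ (m + l * y)) (l * V₂ (m + l * y)) y := by
  have h := ((hasDerivAt_id y).const_mul l).const_add m
  exact ((hV.hasDeriv₁ (m + l * y)).comp y h).congr_deriv (by ring)

lemma hasDerivAt_scaled₂ (hV : ConvexField c V V₁ V₂ V₃) (m l y : ℝ) :
    HasDerivAt (fun y => l * V₂ (m + l * y)) (l ^ 2 * V₃ (m + l * y)) y := by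
  have h := ((hasDerivAt_id y).const_mul l).const_add m
  exact (((hV.hasDeriv₂ (m + l * y)).comp y h).const_mul l).congr_deriv (by ring)

lemma monotone₁ (hV : ConvexField c V V₁ V₂ V₃) : Monotone V₁ :=
  monotone_of_hasDerivAt_nonneg hV.hasDeriv₁ fun x => hV.pos.le.trans (hV.le₂ x)

lemma exists_sign (hV : ConvexField c V V₁ V₂ V₃) : ∃ p : ℝ, 0 ≤ V₁ p ∧ V₁ (-p) ≤ 0 := by
  have hm : Monotone fun x => V₁ x - c * x :=
    monotone_of_hasDerivAt_nonneg (fun x => (hV.hasDeriv₁ x).sub ((hasDerivAt_id x).const_mul c))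
      fun x => by
        change 0 ≤ V₂ x - c * 1
        linarith [hV.le₂ x]
  have hp : 0 ≤ |V₁ 0| / c := div_nonneg (abs_nonneg _) hV.pos.le
  have hc : c * (|V₁ 0| / c) = |V₁ 0| := mul_div_cancel₀ _ hV.pos.ne'
  have h1 := hm hp
  have h2 := hm (neg_nonpos.2 hp)
  simp only [mul_neg, hc, mul_zero] at h1 h2
  exact ⟨|V₁ 0| / c, by linarith [neg_abs_le (V₁ 0)], by linarith [le_abs_self (V₁ 0)]⟩

end ConvexField

namespace IsDensity

variable {c : ℝ} {V V₁ V₂ V₃ : ℝ → ℝ} {m l : ℝ} {φ : ℝ → ℝ}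

lemma apply_one (h : IsDensity V₂ m l φ) : φ 1 = 0 := by
  rw [h.fixed 1 (by norm_num), chebInv_one]

lemma apply_neg_one (h : IsDensity V₂ m l φ) : φ (-1) = 0 := by
  rw [h.fixed (-1) (by norm_num), chebInv_neg_one]

lemma potential_add (h : IsDensity V₂ m l φ) (hV : ConvexField c V V₁ V₂ V₃) (hl : l ≠ 0) :
    ∃ A, ∀ y ∈ Icc (-1 : ℝ) 1, potential (fun u => ker (l * u)) φ y + V (m + l * y) / l
      = A + slope V₁ m l φ * y := by
  obtain ⟨A, hA⟩ := potential_add_eq_affine (admissible_ker l) (hV.hasDerivAt_scaled hl m)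
    (hV.hasDerivAt_scaled₁ m l) (by have := hV.cont₂; fun_prop) h.cont h.cont h.fixed
  exact ⟨A, fun y hy => by rw [slope, ← hA y hy]; ring⟩

lemma differentiableAt (h : IsDensity V₂ m l φ) (hV : ConvexField c V V₁ V₂ V₃) {y : ℝ}
    (hy : y ∈ Ioo (-1 : ℝ) 1) : DifferentiableAt ℝ φ y := by
  have hk₃ := continuous_ker₃
  have hd := differentiableAt_chebInv
    (v := fun y => l * V₂ (m + l * y) - conv (fun u => l ^ 2 * ker₂ (l * u)) φ y)
    (v' := fun y => l ^ 2 * V₃ (m + l * y)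
      - conv (fun u => l ^ 2 * (l * ker₃ (l * u))) φ y) (fun x => by
      refine (hV.hasDerivAt_scaled₂ m l x).sub (hasDerivAt_conv (fun u => ?_) (by fun_prop) h.cont x)
      have := ((hasDerivAt_ker₂ (l * u)).comp u ((hasDerivAt_id u).const_mul l)).const_mul (l ^ 2)
      exact this.congr_deriv (by ring))
    (by
      have := hV.cont₃
      have := continuous_conv (K := fun u => l ^ 2 * (l * ker₃ (l * u))) (by fun_prop) h.cont
      fun_prop) hy
  refine hd.congr_of_eventuallyEq ?_
  filter_upwards [Icc_mem_nhds hy.1 hy.2] with z hz using h.fixed z hz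

end IsDensity

lemma conv_ker₂_sqrt_le {l : ℝ} (hl : 0 ≤ l) (y : ℝ) :
    conv (fun u => l ^ 2 * ker₂ (l * u)) (fun t => √(1 - t ^ 2)) y ≤ 2 * l := by
  have hk := continuous_ker₂
  have h1 : ∫ t in (-1 : ℝ)..1, l ^ 2 * ker₂ (l * (y - t))
      = -(l * ker₁ (l * (y - 1))) - -(l * ker₁ (l * (y - -1))) := by
    refine intervalIntegral.integral_eq_sub_of_hasDerivAt (f := fun t => -(l * ker₁ (l * (y - t))))
      (fun t _ => ?_) ((by fun_prop : Continuous _).intervalIntegrable _ _)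
    have := ((hasDerivAt_ker₁ (l * (y - t))).comp t
      (((hasDerivAt_id t).const_sub y).const_mul l)).const_mul l
    exact this.neg.congr_deriv (by ring)
  have h2 : conv (fun u => l ^ 2 * ker₂ (l * u)) (fun t => √(1 - t ^ 2)) y
      ≤ ∫ t in (-1 : ℝ)..1, l ^ 2 * ker₂ (l * (y - t)) := by
    refine intervalIntegral.integral_mono_on (by norm_num)
      ((by fun_prop : Continuous _).intervalIntegrable _ _)
      ((by fun_prop : Continuous _).intervalIntegrable _ _) fun t _ => ?_
    refine mul_le_of_le_one_right (mul_nonneg (sq_nonneg _) (ker₂_nonneg _)) ?_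
    rw [sqrt_le_one]
    nlinarith [sq_nonneg t]
  have h3 := mul_le_mul_of_nonneg_left (abs_le.1 (abs_ker₁_le (l * (y - 1)))).1 hl
  have h4 := mul_le_mul_of_nonneg_left (abs_le.1 (abs_ker₁_le (l * (y - -1)))).2 hl
  linarith

namespace IsDensity

variable {c : ℝ} {V V₁ V₂ V₃ : ℝ → ℝ} {m l : ℝ} {φ : ℝ → ℝ}

/-- Quantitative positivity of the density. -/
lemma mul_sqrt_le (h : IsDensity V₂ m l φ) (hV : ConvexField c V V₁ V₂ V₃) (hl : 0 < l) {y : ℝ}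
    (hy : y ∈ Icc (-1 : ℝ) 1) : c * l / (2 * π + 2 * l) * √(1 - y ^ 2) ≤ φ y := by
  have hG := admissible_ker l
  set ε := c * l / (2 * π + 2 * l) with hε
  have hpos : 0 < 2 * π + 2 * l := by positivity
  have hc := hV.pos
  have hε0 : 0 ≤ ε := by positivity
  have hφ := h.cont
  have hw : Continuous fun t : ℝ => √(1 - t ^ 2) := by fun_prop
  obtain ⟨A, hA⟩ := h.potential_add hV hl.ne'
  obtain ⟨A', B', hw'⟩ := barrier hG
  have key := nonneg_of_convex (φ := fun t => φ t + (-ε) * √(1 - t ^ 2))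
    (f := fun y => V (m + l * y) / l
      + (-ε) * (π * y ^ 2 + conv (fun u => ker (l * u)) (fun t => √(1 - t ^ 2)) y))
    (A := A + (-ε) * A') (B := slope V₁ m l φ + (-ε) * B') hG (by fun_prop)
    (fun y hy => (h.differentiableAt hV hy).add (DifferentiableAt.const_mul
      (DifferentiableAt.sqrt (by fun_prop) (by nlinarith [hy.1, hy.2])) _))
    (by simp [h.apply_neg_one]) (by simp [h.apply_one]) (fun x r _ _ _ => ?_)
    (fun y hy => ?_) y hy
  · linarith
  · rw [secondDiff_add, secondDiff_const_mul]
    have e1 := secondDiff_ge (hV.hasDerivAt_scaled hl.ne' m) (hV.hasDerivAt_scaled₁ m l)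
      (c := c * l) (fun y => by
        rw [mul_comm c]; exact mul_le_mul_of_nonneg_left (hV.le₂ _) hl.le) x r
    have e2 : secondDiff (fun y => π * y ^ 2 + conv (fun u => ker (l * u))
        (fun t => √(1 - t ^ 2)) y) x r ≤ (2 * π + 2 * l) * r ^ 2 := by
      refine secondDiff_le
        (f₁ := fun y => π * (2 * y) + conv (fun u => l * ker₁ (l * u)) (fun t => √(1 - t ^ 2)) y)
        (f₂ := fun y => π * 2 + conv (fun u => l ^ 2 * ker₂ (l * u)) (fun t => √(1 - t ^ 2)) y)
        (fun y => ?_) (fun y => ?_) (fun y => ?_) x r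
      · exact (((hasDerivAt_pow 2 y).const_mul π).add
          (hasDerivAt_conv hG.hasDeriv hG.continuous₁ hw y)).congr_deriv (by norm_num)
      · exact ((((hasDerivAt_id y).const_mul 2).const_mul π).add
          (hasDerivAt_conv hG.hasDeriv₁ hG.cont₂ hw y)).congr_deriv (by norm_num)
      · linarith [conv_ker₂_sqrt_le hl.le y]
    have e3 := mul_le_mul_of_nonneg_left e2 hε0
    have e4 : ε * ((2 * π + 2 * l) * r ^ 2) = c * l * r ^ 2 := by
      rw [hε]; field_simp
    linarith
  · have hc2 : Continuous fun t : ℝ => (-ε) * √(1 - t ^ 2) := by fun_prop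
    rw [OneCut.potential_add hG.continuous hφ.continuousOn hc2.continuousOn, potential_const_mul]
    linear_combination hA y hy + (-ε) * hw' y hy

lemma nonneg (h : IsDensity V₂ m l φ) (hV : ConvexField c V V₁ V₂ V₃) (hl : 0 < l) {y : ℝ}
    (hy : y ∈ Icc (-1 : ℝ) 1) : 0 ≤ φ y := by
  have := hV.pos
  exact le_trans (by positivity) (h.mul_sqrt_le hV hl hy)

lemma pos (h : IsDensity V₂ m l φ) (hV : ConvexField c V V₁ V₂ V₃) (hl : 0 < l) {y : ℝ}
    (hy : y ∈ Ioo (-1 : ℝ) 1) : 0 < φ y := by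
  have := hV.pos
  have : 0 < √(1 - y ^ 2) := sqrt_pos.2 (by nlinarith [hy.1, hy.2])
  exact lt_of_lt_of_le (by positivity) (h.mul_sqrt_le hV hl ⟨hy.1.le, hy.2.le⟩)

lemma mass_ge (h : IsDensity V₂ m l φ) (hV : ConvexField c V V₁ V₂ V₃) (hl : 0 < l) :
    c * l ^ 2 * π / (4 * (π + l)) ≤ l * ∫ t in (-1 : ℝ)..1, φ t := by
  have h1 : ∫ t in (-1 : ℝ)..1, c * l / (2 * π + 2 * l) * √(1 - t ^ 2) ≤ ∫ t in (-1 : ℝ)..1, φ t :=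
    intervalIntegral.integral_mono_on (by norm_num)
      ((by fun_prop : Continuous _).intervalIntegrable _ _) (h.cont.intervalIntegrable _ _)
      fun t ht => h.mul_sqrt_le hV hl ht
  rw [intervalIntegral.integral_const_mul, integral_sqrt_one_sub_sq] at h1
  refine le_trans (le_of_eq ?_) (mul_le_mul_of_nonneg_left h1 hl.le)
  have : π + l ≠ 0 := by positivity
  have : 2 * π + 2 * l ≠ 0 := by positivity
  field_simp
  ring

/-- Square root vanishing at the right endpoint. -/
lemma tendsto_div_right (h : IsDensity V₂ m l φ) (hV : ConvexField c V V₁ V₂ V₃) (hl : 0 < l) :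
    ∃ a, a ≠ 0 ∧ Tendsto (fun y => φ y / √(1 - y)) (𝓝[<] 1) (𝓝 a) := by
  have hk := continuous_ker₂
  have := hV.cont₂
  have := continuous_conv (K := fun u => l ^ 2 * ker₂ (l * u)) (by fun_prop) h.cont
  obtain ⟨a, ha⟩ := tendsto_chebInv_div_right
    (v := fun y => l * V₂ (m + l * y) - conv (fun u => l ^ 2 * ker₂ (l * u)) φ y) (by fun_prop)
  have hmem : Ioo (0 : ℝ) 1 ∈ 𝓝[<] (1 : ℝ) := Ioo_mem_nhdsLT (by norm_num)
  have ha' : Tendsto (fun y => φ y / √(1 - y)) (𝓝[<] 1) (𝓝 a) := by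
    refine ha.congr' ?_
    filter_upwards [hmem] with y hy
    rw [h.fixed y ⟨by linarith [hy.1], hy.2.le⟩]
  have hc := hV.pos
  have hε : 0 < c * l / (2 * π + 2 * l) := by positivity
  refine ⟨a, (hε.trans_le (ge_of_tendsto ha' ?_)).ne', ha'⟩
  filter_upwards [hmem] with y hy
  have h1 : 0 < √(1 - y) := sqrt_pos.2 (by linarith [hy.2])
  rw [le_div_iff₀ h1]
  refine le_trans ?_ (h.mul_sqrt_le hV hl ⟨by linarith [hy.1], hy.2.le⟩)
  refine mul_le_mul_of_nonneg_left (sqrt_le_sqrt ?_) hε.le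
  nlinarith [hy.1, hy.2]

/-- Square root vanishing at the left endpoint. -/
lemma tendsto_div_left (h : IsDensity V₂ m l φ) (hV : ConvexField c V V₁ V₂ V₃) (hl : 0 < l) :
    ∃ a, a ≠ 0 ∧ Tendsto (fun y => φ y / √(1 + y)) (𝓝[>] (-1)) (𝓝 a) := by
  have hk := continuous_ker₂
  have := hV.cont₂
  have := continuous_conv (K := fun u => l ^ 2 * ker₂ (l * u)) (by fun_prop) h.cont
  obtain ⟨a, ha⟩ := tendsto_chebInv_div_left
    (v := fun y => l * V₂ (m + l * y) - conv (fun u => l ^ 2 * ker₂ (l * u)) φ y) (by fun_prop)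
  have hmem : Ioo (-1 : ℝ) 0 ∈ 𝓝[>] (-1 : ℝ) := Ioo_mem_nhdsGT (by norm_num)
  have ha' : Tendsto (fun y => φ y / √(1 + y)) (𝓝[>] (-1)) (𝓝 a) := by
    refine ha.congr' ?_
    filter_upwards [hmem] with y hy
    rw [h.fixed y ⟨hy.1.le, by linarith [hy.2]⟩]
  have hc := hV.pos
  have hε : 0 < c * l / (2 * π + 2 * l) := by positivity
  refine ⟨a, (hε.trans_le (ge_of_tendsto ha' ?_)).ne', ha'⟩
  filter_upwards [hmem] with y hy
  have h1 : 0 < √(1 + y) := sqrt_pos.2 (by linarith [hy.1])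
  rw [le_div_iff₀ h1]
  refine le_trans ?_ (h.mul_sqrt_le hV hl ⟨hy.1.le, by linarith [hy.2]⟩)
  refine mul_le_mul_of_nonneg_left (sqrt_le_sqrt ?_) hε.le
  nlinarith [hy.1, hy.2]

lemma slope_le (h : IsDensity V₂ m l φ) (hV : ConvexField c V V₁ V₂ V₃) (hl : 0 < l) :
    slope V₁ m l φ ≤ V₁ (m + l) := by
  obtain ⟨A, hA⟩ := h.potential_add hV hl.ne'
  have hd := hV.hasDerivAt_scaled hl.ne' m 1
  rw [mul_one] at hd
  exact slope_le_deriv (admissible_ker l) h.cont (fun t ht => h.nonneg hV hl ht) h.apply_one hd hA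

lemma le_slope (h : IsDensity V₂ m l φ) (hV : ConvexField c V V₁ V₂ V₃) (hl : 0 < l) :
    V₁ (m - l) ≤ slope V₁ m l φ := by
  obtain ⟨A, hA⟩ := h.potential_add hV hl.ne'
  have hφ := h.cont
  have hd := (hV.hasDerivAt_scaled hl.ne' m (-1)).comp_of_eq 1 (hasDerivAt_neg 1) rfl
  rw [show m + l * -1 = m - l by ring] at hd
  have := slope_le_deriv (φ := fun t => φ (-t)) (A := A) (B := -slope V₁ m l φ) (admissible_ker l)
    (by fun_prop) (fun t ht => h.nonneg hV hl ⟨by linarith [ht.2], by linarith [ht.1]⟩)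
    h.apply_neg_one hd fun y hy => by
      rw [potential_comp_neg (admissible_ker l)]
      exact (hA (-y) ⟨by linarith [hy.2], by linarith [hy.1]⟩).trans (by ring)
  linarith

end IsDensity

lemma potential_mul_left {φ : ℝ → ℝ} (hφ : Continuous φ) (l : ℝ) {r : ℝ} (hr : 0 < r) :
    ∃ C, ∀ y, potential (fun u => ker (l * u)) φ (r * y)
      = r * (∫ s in (-r⁻¹)..r⁻¹, logKer (fun u => ker (l * r * u)) (y - s) * φ (r * s)) + C := by
  have hk := continuous_ker
  refine ⟨-(r * ∫ s in (-r⁻¹)..r⁻¹, 2 * log r * φ (r * s)), fun y => ?_⟩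
  have h1 := intervalIntegral.mul_integral_comp_mul_left (a := -r⁻¹) (b := r⁻¹)
    (f := fun t => logKer (fun u => ker (l * u)) (r * y - t) * φ t) r
  rw [mul_neg, mul_inv_cancel₀ hr.ne'] at h1
  have h2 : Continuous fun s => φ (r * s) := by fun_prop
  have hi := intervalIntegrable_logKer (G := fun u => ker (l * r * u)) (by fun_prop)
    (a := -r⁻¹) (b := r⁻¹) h2.continuousOn y
  have hi' : IntervalIntegrable (fun s => 2 * log r * φ (r * s)) volume (-r⁻¹) r⁻¹ :=
    (by fun_prop : Continuous _).intervalIntegrable _ _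
  unfold potential
  rw [← h1, ← sub_eq_add_neg, ← mul_sub, ← intervalIntegral.integral_sub hi hi']
  congr 1
  refine intervalIntegral.integral_congr_ae ?_
  filter_upwards [compl_mem_ae_iff.2 (measure_singleton y)] with s hs _
  have hs' : y - s ≠ 0 := sub_ne_zero.2 (Ne.symm hs)
  unfold logKer
  rw [← mul_sub, log_mul hr.ne' hs']
  beta_reduce
  rw [mul_assoc l r]
  ring

lemma secondDiff_outer_nonneg {G G₁ G₂ φ : ℝ → ℝ} (hG : Admissible G G₁ G₂) (hφ : Continuous φ)
    {a b : ℝ} (hab : a ≤ b) (h0 : ∀ t ∈ Icc a b, 0 ≤ φ t) (h1 : ∀ t ∈ Icc a b, 1 ≤ |t|)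
    {x h : ℝ} (hh : 0 < h) (hl : -1 < x - h) (hr : x + h < 1) :
    0 ≤ secondDiff (fun y => ∫ t in a..b, logKer G (y - t) * φ t) x h := by
  rw [secondDiff_integral_logKer hG.continuous hφ.continuousOn]
  refine intervalIntegral.integral_nonneg hab fun t ht => ?_
  refine mul_nonneg (hG.secondDiff_logKer_nonneg hh ?_) (h0 t ht)
  rcases le_abs'.1 (h1 t ht) with h | h
  · rw [lt_abs]; left; linarith
  · rw [lt_abs]; right; linarith

namespace IsDensity

variable {c : ℝ} {V V₁ V₂ V₃ : ℝ → ℝ} {m : ℝ}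

/-- Comparison of the solutions on two concentric intervals. -/
lemma le_of_lt {l₁ l₂ : ℝ} {φ₁ φ₂ : ℝ → ℝ} (h₁ : IsDensity V₂ m l₁ φ₁) (h₂ : IsDensity V₂ m l₂ φ₂)
    (hV : ConvexField c V V₁ V₂ V₃) (hl₁ : 0 < l₁) (hlt : l₁ < l₂) {y : ℝ}
    (hy : y ∈ Icc (-1 : ℝ) 1) : φ₁ y ≤ φ₂ (l₁ / l₂ * y) := by
  have hl₂ := hl₁.trans hlt
  set r := l₁ / l₂ with hr
  have hr0 : 0 < r := by positivity
  have hr1 : r < 1 := (div_lt_one hl₂).2 hlt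
  have hlr : l₂ * r = l₁ := by rw [hr]; field_simp
  have hG := admissible_ker l₁
  have hφ₁ := h₁.cont
  have hφ₂ := h₂.cont
  obtain ⟨A₁, hA₁⟩ := h₁.potential_add hV hl₁.ne'
  obtain ⟨A₂, hA₂⟩ := h₂.potential_add hV hl₂.ne'
  obtain ⟨C, hC⟩ := potential_mul_left hφ₂ l₂ hr0
  rw [hlr] at hC
  set χ : ℝ → ℝ := fun s => φ₂ (r * s) with hχ
  have hχc : Continuous χ := by fun_prop
  have hrinv : 1 < r⁻¹ := (one_lt_inv₀ hr0).2 hr1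
  have hχ0 : ∀ t, |t| ≤ r⁻¹ → 0 ≤ χ t := fun t ht => by
    refine h₂.nonneg hV hl₂ (abs_le.1 ?_)
    rw [abs_mul, abs_of_pos hr0]
    calc r * |t| ≤ r * r⁻¹ := mul_le_mul_of_nonneg_left ht hr0.le
      _ = 1 := mul_inv_cancel₀ hr0.ne'
  set f : ℝ → ℝ := fun y => (∫ s in (-r⁻¹)..(-1), logKer (fun u => ker (l₁ * u)) (y - s) * χ s)
    + ∫ s in (1 : ℝ)..r⁻¹, logKer (fun u => ker (l₁ * u)) (y - s) * χ s with hf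
  have hsplit : ∀ y, potential (fun u => ker (l₁ * u)) χ y + f y
      = ∫ s in (-r⁻¹)..r⁻¹, logKer (fun u => ker (l₁ * u)) (y - s) * χ s := fun y => by
    have hi : ∀ a b, IntervalIntegrable (fun s => logKer (fun u => ker (l₁ * u)) (y - s) * χ s)
        volume a b := fun a b => intervalIntegrable_logKer hG.continuous hχc.continuousOn y
    rw [← intervalIntegral.integral_add_adjacent_intervals (hi (-r⁻¹) (-1)) (hi (-1) r⁻¹),
      ← intervalIntegral.integral_add_adjacent_intervals (hi (-1) 1) (hi 1 r⁻¹), hf, potential]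
    ring
  have key := nonneg_of_convex (φ := fun t => χ t + (-1) * φ₁ t) (f := f)
    (A := (A₂ - C) / r - A₁) (B := slope V₁ m l₂ φ₂ - slope V₁ m l₁ φ₁) hG (by fun_prop)
    (fun y hy => ?_) ?_ ?_ (fun x h hh hl hr => ?_) (fun y hy => ?_) y hy
  · linarith
  · refine DifferentiableAt.add ?_ ((h₁.differentiableAt hV hy).const_mul _)
    refine (h₂.differentiableAt hV ⟨?_, ?_⟩ : DifferentiableAt ℝ φ₂ (r * y)).comp y (by fun_prop)
    · nlinarith [hy.1]
    · nlinarith [hy.2]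
  · simpa [h₁.apply_neg_one] using hχ0 (-1) (by rw [abs_neg, abs_one]; exact hrinv.le)
  · simpa [h₁.apply_one] using hχ0 1 (by rw [abs_one]; exact hrinv.le)
  · rw [hf, secondDiff_add]
    refine add_nonneg (secondDiff_outer_nonneg hG hχc (by linarith) (fun t ht => hχ0 t ?_)
      (fun t ht => ?_) hh hl hr) (secondDiff_outer_nonneg hG hχc hrinv.le (fun t ht => hχ0 t ?_)
      (fun t ht => ?_) hh hl hr)
    · exact abs_le.2 ⟨ht.1, by linarith [ht.2]⟩
    · exact le_abs'.2 (Or.inl ht.2)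
    · exact abs_le.2 ⟨by linarith [ht.1], ht.2⟩
    · exact le_abs'.2 (Or.inr ht.1)
  · have hc2 : Continuous fun t => -1 * φ₁ t := by fun_prop
    rw [OneCut.potential_add hG.continuous hχc.continuousOn hc2.continuousOn, potential_const_mul]
    have hry : r * y ∈ Icc (-1 : ℝ) 1 := ⟨by nlinarith [hy.1], by nlinarith [hy.2]⟩
    have e1 := hA₁ y hy
    have e2 := hA₂ _ hry
    rw [hC, ← hsplit, ← mul_assoc, hlr] at e2
    have e3 : V (m + l₁ * y) / l₂ = r * (V (m + l₁ * y) / l₁) := by rw [hr]; field_simp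
    rw [e3] at e2
    have e4 : potential (fun u => ker (l₁ * u)) χ y + f y + V (m + l₁ * y) / l₁
        = (A₂ - C) / r + slope V₁ m l₂ φ₂ * y := by
      field_simp
      field_simp at e2
      linarith
    linarith

lemma mass_lt {l₁ l₂ : ℝ} {φ₁ φ₂ : ℝ → ℝ} (h₁ : IsDensity V₂ m l₁ φ₁) (h₂ : IsDensity V₂ m l₂ φ₂)
    (hV : ConvexField c V V₁ V₂ V₃) (hl₁ : 0 < l₁) (hlt : l₁ < l₂) :
    l₁ * ∫ t in (-1 : ℝ)..1, φ₁ t < l₂ * ∫ t in (-1 : ℝ)..1, φ₂ t := by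
  have hl₂ := hl₁.trans hlt
  set r := l₁ / l₂ with hr
  have hr0 : 0 < r := by positivity
  have hr1 : r < 1 := (div_lt_one hl₂).2 hlt
  have hφ₂ := h₂.cont
  have hχc : Continuous fun s => φ₂ (r * s) := by fun_prop
  have e1 := intervalIntegral.mul_integral_comp_mul_left (a := -1) (b := 1) (f := φ₂) r
  have e2 : ∫ t in (-1 : ℝ)..1, φ₁ t ≤ ∫ t in (-1 : ℝ)..1, φ₂ (r * t) :=
    intervalIntegral.integral_mono_on (by norm_num) (h₁.cont.intervalIntegrable _ _)
      (hχc.intervalIntegrable _ _) fun t ht => h₁.le_of_lt h₂ hV hl₁ hlt ht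
  rw [mul_neg, mul_one] at e1
  have hi : ∀ a b, IntervalIntegrable φ₂ volume a b := hφ₂.intervalIntegrable
  have e3 : 0 ≤ ∫ t in (-1 : ℝ)..(-r), φ₂ t :=
    intervalIntegral.integral_nonneg (by linarith) fun t ht =>
      h₂.nonneg hV hl₂ ⟨ht.1, by linarith [ht.2]⟩
  have e4 : 0 < ∫ t in r..1, φ₂ t :=
    intervalIntegral.intervalIntegral_pos_of_pos_on (hi _ _)
      (fun t ht => h₂.pos hV hl₂ ⟨by linarith [ht.1], ht.2⟩) hr1
  have e5 := intervalIntegral.integral_add_adjacent_intervals (hi (-1) (-r)) (hi (-r) 1)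
  have e6 := intervalIntegral.integral_add_adjacent_intervals (hi (-r) r) (hi r 1)
  calc l₁ * ∫ t in (-1 : ℝ)..1, φ₁ t ≤ l₁ * ∫ t in (-1 : ℝ)..1, φ₂ (r * t) :=
        mul_le_mul_of_nonneg_left e2 hl₁.le
    _ = l₂ * ∫ t in (-r)..r, φ₂ t := by
        rw [← e1, ← mul_assoc]; congr 1; rw [hr]; field_simp
    _ < l₂ * ∫ t in (-1 : ℝ)..1, φ₂ t := mul_lt_mul_of_pos_left (by linarith) hl₂

end IsDensity

/-- The zero set of a family of strictly increasing continuous functions is a continuous graph. -/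
lemma continuous_of_implicit {M : ℝ × ℝ → ℝ} (hM : Continuous M)
    (hmono : ∀ m l l', 0 < l → l < l' → M (m, l) < M (m, l')) {a : ℝ} {ρ : ℝ → ℝ}
    (hρ : ∀ m, 0 < ρ m) (ha : ∀ m, M (m, ρ m) = a) : Continuous ρ := by
  rw [continuous_iff_continuousAt]
  intro m
  rw [ContinuousAt, tendsto_order]
  have hc : ∀ l, Continuous fun m' => M (m', l) := fun l => by fun_prop
  refine ⟨fun l hl => ?_, fun l hl => ?_⟩
  · rcases le_or_gt l 0 with h0 | h0
    · exact Eventually.of_forall fun m' => h0.trans_lt (hρ m')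
    · have h1 : M (m, l) < a := ha m ▸ hmono m l _ h0 hl
      filter_upwards [((hc l).tendsto m).eventually_lt_const h1] with m' hm'
      by_contra! hle
      rcases hle.eq_or_lt with h | h
      · rw [← h, ha] at hm'; exact hm'.false
      · exact (hm'.trans (ha m' ▸ hmono m' _ l (hρ m') h)).false
  · have h1 : a < M (m, l) := ha m ▸ hmono m _ l (hρ m) hl
    filter_upwards [((hc l).tendsto m).eventually_const_lt h1] with m' hm'
    by_contra! hle
    rcases hle.eq_or_lt with h | h
    · rw [h, ha] at hm'; exact hm'.false
    · exact (hm'.trans (ha m' ▸ hmono m' l _ ((hρ m).trans hl) h)).false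

/-- A unit mass density with vanishing slope. -/
lemma ConvexField.exists_density {c : ℝ} {V V₁ V₂ V₃ : ℝ → ℝ} (hV : ConvexField c V V₁ V₂ V₃) :
    ∃ m l φ, 0 < l ∧ IsDensity V₂ m l φ ∧ l * ∫ t in (-1 : ℝ)..1, φ t = 1 ∧ slope V₁ m l φ = 0 := by
  obtain ⟨φ, hφ, hfix⟩ := exists_solution hV.cont₂
  have hd : ∀ m l, IsDensity V₂ m l (φ m l) := fun m l => ⟨by fun_prop, hfix m l⟩
  set M : ℝ × ℝ → ℝ := fun p => p.2 * ∫ t in (-1 : ℝ)..1, φ p.1 p.2 t with hM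
  have hMc : Continuous M := by
    refine continuous_snd.mul
      (intervalIntegral.continuous_parametric_intervalIntegral_of_continuous' ?_ _ _)
    fun_prop
  have hmono : ∀ m l l', 0 < l → l < l' → M (m, l) < M (m, l') := fun m l l' hl hlt =>
    (hd m l).mass_lt (hd m l') hV hl hlt
  have hc := hV.pos
  set L := π + 8 / (c * π) with hL
  have hL0 : 0 < L := by positivity
  have hML : ∀ m, 1 ≤ M (m, L) := fun m => by
    refine le_trans ?_ ((hd m L).mass_ge hV hL0)
    have h1 : π ≤ L := by rw [hL]; linarith [show 0 < 8 / (c * π) by positivity]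
    have h2 : 8 ≤ c * π * L := by
      have : c * π * (8 / (c * π)) = 8 := by field_simp
      have : 0 ≤ c * π * π := by positivity
      rw [hL]; linarith
    rw [le_div_iff₀ (by positivity)]
    nlinarith
  have hex : ∀ m, ∃ l, 0 < l ∧ l ≤ L ∧ M (m, l) = 1 := fun m => by
    have hcont : ContinuousOn (fun l => M (m, l)) (Icc 0 L) := by fun_prop
    have h0 : M (m, 0) = 0 := by simp [hM]
    obtain ⟨l, hl, h1⟩ := intermediate_value_Icc hL0.le hcont
      (show (1 : ℝ) ∈ Icc (M (m, 0)) (M (m, L)) from ⟨by rw [h0]; norm_num, hML m⟩)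
    refine ⟨l, lt_of_le_of_ne hl.1 ?_, hl.2, h1⟩
    rintro rfl
    exact zero_ne_one (h0.symm.trans h1)
  choose ρ hρ0 hρL hρ1 using hex
  have hρ := continuous_of_implicit hMc hmono hρ0 hρ1
  have hslope : Continuous fun p : ℝ × ℝ => slope V₁ p.1 p.2 (φ p.1 p.2) := by
    have hk := continuous_ker₁
    have hV₁ := hV.cont₁
    refine continuous_const.mul
      (intervalIntegral.continuous_parametric_intervalIntegral_of_continuous' ?_ _ _)
    refine Continuous.sub (by fun_prop) ?_
    have : Continuous fun q : (ℝ × ℝ) × ℝ => ∫ t in (-1 : ℝ)..1,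
        q.1.2 * ker₁ (q.1.2 * (cos q.2 - t)) * φ q.1.1 q.1.2 t :=
      intervalIntegral.continuous_parametric_intervalIntegral_of_continuous' (by fun_prop) _ _
    exact this
  have hs : Continuous fun m => slope V₁ m (ρ m) (φ m (ρ m)) :=
    hslope.comp (continuous_id.prodMk hρ)
  obtain ⟨p, hp, hp'⟩ := hV.exists_sign
  have h1 : slope V₁ (-p - L) (ρ (-p - L)) (φ (-p - L) (ρ (-p - L))) ≤ 0 :=
    ((hd _ _).slope_le hV (hρ0 _)).trans
      ((hV.monotone₁ (by linarith [hρL (-p - L)])).trans hp')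
  have h2 : 0 ≤ slope V₁ (p + L) (ρ (p + L)) (φ (p + L) (ρ (p + L))) :=
    (hp.trans (hV.monotone₁ (by linarith [hρL (p + L)]))).trans ((hd _ _).le_slope hV (hρ0 _))
  obtain ⟨m, hm⟩ := mem_range_of_exists_le_of_exists_ge hs ⟨_, h1⟩ ⟨_, h2⟩
  exact ⟨m, ρ m, φ m (ρ m), hρ0 m, hd m (ρ m), hρ1 m, hm⟩

lemma intervalIntegrable_log_abs_sub {ψ : ℝ → ℝ} (hψ : Continuous ψ) (a b x : ℝ) :
    IntervalIntegrable (fun t => -log |t - x| * ψ t) volume a b := by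
  refine IntervalIntegrable.mul_continuousOn ?_ hψ.continuousOn
  refine ((intervalIntegrable_log_sub x a b).neg).congr fun t _ => ?_
  change -log (x - t) = -log |t - x|
  rw [log_abs, ← log_neg_eq_log, neg_sub]

lemma log_exp_ae_eq (ψ : ℝ → ℝ) (a b x : ℝ) :
    (fun t => -log |exp t - exp x| * ψ t) =ᵐ[volume.restrict (uIoc a b)]
      fun t => -log |t - x| * ψ t + (-((t + x) / 2) - ker (t - x)) * ψ t := by
  refine ae_restrict_of_ae ?_
  filter_upwards [compl_mem_ae_iff.2 (measure_singleton x)] with t ht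
  rw [log_exp_sub_exp ht]
  ring

lemma intervalIntegrable_log_abs_exp_sub {ψ : ℝ → ℝ} (hψ : Continuous ψ) (a b x : ℝ) :
    IntervalIntegrable (fun t => -log |exp t - exp x| * ψ t) volume a b := by
  have hk := continuous_ker
  exact ((intervalIntegrable_log_abs_sub hψ a b x).add
    ((by fun_prop : Continuous fun t => (-((t + x) / 2) - ker (t - x)) * ψ t).intervalIntegrable
      a b)).congr_ae (log_exp_ae_eq ψ a b x).symm

/-- The sum of the two logarithmic potentials in rescaled coordinates. -/
lemma log_integrals_eq {φ : ℝ → ℝ} (hφ : Continuous φ) (m : ℝ) {l : ℝ} (hl : 0 < l)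
    (h1 : l * ∫ t in (-1 : ℝ)..1, φ t = 1) : ∃ C, ∀ y,
    (∫ t in (m - l)..(m + l), -log |t - (m + l * y)| * φ ((t - m) / l))
      + (∫ t in (m - l)..(m + l), -log |exp t - exp (m + l * y)| * φ ((t - m) / l))
      = l * potential (fun u => ker (l * u)) φ y - (m + l * y) / 2 + C := by
  have hk := continuous_ker
  have hψ : Continuous fun t => φ ((t - m) / l) := by fun_prop
  refine ⟨-2 * log l - l * (∫ s in (-1 : ℝ)..1, (m + l * s) / 2 * φ s), fun y => ?_⟩
  set x := m + l * y with hx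
  have hi1 := intervalIntegrable_log_abs_sub hψ (m - l) (m + l) x
  have hi2 := intervalIntegrable_log_abs_exp_sub hψ (m - l) (m + l) x
  rw [← intervalIntegral.integral_add hi1 hi2]
  have h2 := intervalIntegral.mul_integral_comp_add_mul (a := -1) (b := 1)
    (f := fun t => -log |t - x| * φ ((t - m) / l) + -log |exp t - exp x| * φ ((t - m) / l)) l m
  rw [show m + l * -1 = m - l by ring, mul_one] at h2
  rw [← h2]
  have i0 : IntervalIntegrable φ volume (-1) 1 := hφ.intervalIntegrable _ _
  have i1 := intervalIntegrable_logKer (G := fun u => ker (l * u)) (by fun_prop)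
    (a := -1) (b := 1) hφ.continuousOn y
  have i2 : IntervalIntegrable (fun s => (m + l * s) / 2 * φ s) volume (-1) 1 :=
    (by fun_prop : Continuous _).intervalIntegrable _ _
  have h3 : (∫ s in (-1 : ℝ)..1, (-log |m + l * s - x| * φ ((m + l * s - m) / l)
      + -log |exp (m + l * s) - exp x| * φ ((m + l * s - m) / l)))
      = ∫ s in (-1 : ℝ)..1, (logKer (fun u => ker (l * u)) (y - s) * φ s
        + ((-2 * log l - x / 2) * φ s - (m + l * s) / 2 * φ s)) := by
    refine intervalIntegral.integral_congr_ae ?_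
    filter_upwards [compl_mem_ae_iff.2 (measure_singleton y)] with s hs _
    have hs' : y - s ≠ 0 := sub_ne_zero.2 (Ne.symm hs)
    have e1 : m + l * s - x = -(l * (y - s)) := by rw [hx]; ring
    have e2 : m + l * s ≠ x := fun h => by
      rw [h, sub_self, zero_eq_neg] at e1
      exact (mul_ne_zero hl.ne' hs') e1
    rw [log_exp_sub_exp e2, log_abs, e1, log_neg_eq_log, log_mul hl.ne' hs', ker_neg,
      show (m + l * s - m) / l = s by field_simp; ring, logKer]
    ring
  rw [h3, intervalIntegral.integral_add i1 ((i0.const_mul _).sub i2),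
    intervalIntegral.integral_sub (i0.const_mul _) i2, intervalIntegral.integral_const_mul]
  unfold potential
  linear_combination (-2 * log l - x / 2) * h1

lemma ConvexField.exists_oneCutData {c : ℝ} {V V₁ V₂ V₃ : ℝ → ℝ} (hV : ConvexField c V V₁ V₂ V₃) :
    ∃ a b ψ ℓ, OneCutData (fun x => V x + x / 2) a b ψ ℓ := by
  obtain ⟨m, l, φ, hl, h, hmass, hslope⟩ := hV.exists_density
  have hφ := h.cont
  have hψ : Continuous fun t => φ ((t - m) / l) := by fun_prop
  have hG := admissible_ker l
  obtain ⟨C, hC⟩ := log_integrals_eq hφ m hl hmass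
  obtain ⟨A, hA⟩ := h.potential_add hV hl.ne'
  simp only [hslope, zero_mul, add_zero] at hA
  have hexp : ∀ x, (∫ t in (m - l)..(m + l), -log |t - x| * φ ((t - m) / l))
      + (∫ t in (m - l)..(m + l), -log |exp t - exp x| * φ ((t - m) / l))
      + (V x + x / 2) + -(C + l * A)
      = l * (potential (fun u => ker (l * u)) φ ((x - m) / l)
        + V (m + l * ((x - m) / l)) / l - A) := fun x => by
    have e := hC ((x - m) / l)
    have hx : m + l * ((x - m) / l) = x := by field_simp; ring
    rw [hx] at e ⊢
    rw [e]
    field_simp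
    ring
  have hmem : ∀ x ∈ Icc (m - l) (m + l), (x - m) / l ∈ Icc (-1 : ℝ) 1 := fun x hx =>
    ⟨by rw [le_div_iff₀ hl]; linarith [hx.1], by rw [div_le_iff₀ hl]; linarith [hx.2]⟩
  have hmem' : ∀ x ∈ Ioo (m - l) (m + l), (x - m) / l ∈ Ioo (-1 : ℝ) 1 := fun x hx =>
    ⟨by rw [lt_div_iff₀ hl]; linarith [hx.1], by rw [div_lt_iff₀ hl]; linarith [hx.2]⟩
  have hnn : ∀ t ∈ Icc (-1 : ℝ) 1, 0 ≤ φ t := fun t ht => h.nonneg hV hl ht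
  have hcl : 0 < c * l := mul_pos hV.pos hl
  have hVl : ∀ y, c * l ≤ l * V₂ (m + l * y) := fun y => by
    rw [mul_comm c]; exact mul_le_mul_of_nonneg_left (hV.le₂ _) hl.le
  refine ⟨m - l, m + l, fun t => φ ((t - m) / l), -(C + l * A), ?_⟩
  constructor
  · linarith
  · exact hψ.continuousOn
  · exact fun x hx => hnn _ (hmem x hx)
  · have h2 := intervalIntegral.mul_integral_comp_add_mul (a := -1) (b := 1)
      (f := fun t => φ ((t - m) / l)) l m
    rw [show m + l * -1 = m - l by ring, mul_one] at h2
    have e : ∀ s, (m + l * s - m) / l = s := fun s => by field_simp; ring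
    simp only [e] at h2
    exact h2.symm.trans hmass
  · exact fun x hx => h.pos hV hl (hmem' x hx)
  · obtain ⟨q, hq, hlim⟩ := h.tendsto_div_left hV hl
    refine ⟨q * (√l)⁻¹, mul_ne_zero hq (by positivity), ?_⟩
    have ht : Tendsto (fun x => (x - m) / l) (𝓝[>] (m - l)) (𝓝[>] (-1)) := by
      refine tendsto_nhdsWithin_iff.2 ⟨?_, ?_⟩
      · have := (by fun_prop : Continuous fun x => (x - m) / l).tendsto (m - l)
        rw [show (m - l - m) / l = -1 by field_simp; ring] at this
        exact this.mono_left nhdsWithin_le_nhds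
      · filter_upwards [self_mem_nhdsWithin] with x hx
        have : m - l < x := hx
        exact mem_Ioi.2 (by rw [lt_div_iff₀ hl]; linarith)
    refine ((hlim.comp ht).mul_const (√l)⁻¹).congr fun x => ?_
    simp only [Function.comp]
    rw [div_mul_eq_mul_div, ← div_eq_mul_inv, div_div, ← sqrt_mul hl.le]
    congr 2; field_simp; ring
  · obtain ⟨q, hq, hlim⟩ := h.tendsto_div_right hV hl
    refine ⟨q * (√l)⁻¹, mul_ne_zero hq (by positivity), ?_⟩
    have ht : Tendsto (fun x => (x - m) / l) (𝓝[<] (m + l)) (𝓝[<] 1) := by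
      refine tendsto_nhdsWithin_iff.2 ⟨?_, ?_⟩
      · have := (by fun_prop : Continuous fun x => (x - m) / l).tendsto (m + l)
        rw [show (m + l - m) / l = 1 by field_simp; ring] at this
        exact this.mono_left nhdsWithin_le_nhds
      · filter_upwards [self_mem_nhdsWithin] with x hx
        have : x < m + l := hx
        exact mem_Iio.2 (by rw [div_lt_iff₀ hl]; linarith)
    refine ((hlim.comp ht).mul_const (√l)⁻¹).congr fun x => ?_
    simp only [Function.comp]
    rw [div_mul_eq_mul_div, ← div_eq_mul_inv, div_div, ← sqrt_mul hl.le]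
    congr 2; field_simp; ring
  · exact fun x _ => intervalIntegrable_log_abs_sub hψ _ _ x
  · exact fun x _ => intervalIntegrable_log_abs_exp_sub hψ _ _ x
  · intro x hx
    rw [hexp, hA _ (hmem x hx), sub_self, mul_zero]
  · intro x hx
    rw [hexp]
    refine mul_pos hl (sub_pos.2 ?_)
    rcases not_and_or.1 hx with h' | h'
    · have hy : 1 < -((x - m) / l) := by
        rw [← neg_div, lt_div_iff₀ hl]; linarith [not_le.1 h']
      have := lt_potential_add_of_one_lt (φ := fun t => φ (-t))
        (F := fun y => V (m + l * -y) / l) (F₁ := fun y => -V₁ (m + l * -y))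
        (F₂ := fun y => l * V₂ (m + l * -y)) (A := A) hG (by fun_prop)
        (fun t ht => hnn _ ⟨by linarith [ht.2], by linarith [ht.1]⟩) h.apply_neg_one hcl
        (fun y => ((hV.hasDerivAt_scaled hl.ne' m (-y)).comp y (hasDerivAt_neg y)).congr_deriv
          (by ring))
        (fun y => ((hV.hasDerivAt_scaled₁ m l (-y)).comp y (hasDerivAt_neg y)).neg.congr_deriv
          (by ring))
        (fun y => hVl (-y))
        (fun y hy => by
          rw [potential_comp_neg hG]
          exact hA (-y) ⟨by linarith [hy.2], by linarith [hy.1]⟩) hy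
      rwa [potential_comp_neg hG, neg_neg] at this
    · have hy : 1 < (x - m) / l := by
        rw [lt_div_iff₀ hl]; linarith [not_le.1 h']
      exact lt_potential_add_of_one_lt hG hφ hnn h.apply_one hcl (hV.hasDerivAt_scaled hl.ne' m)
        (hV.hasDerivAt_scaled₁ m l) hVl hA hy

end OneCut

/-- **Theorem: convex implies one-cut regular.** A real analytic, strongly convex
external field `V` is one-cut regular. -/
theorem strongly_convex_is_one_cut_regular
    (V : ℝ → ℝ) (hanalytic : ∀ x : ℝ, AnalyticAt ℝ V x)
    (hconv : ∃ c : ℝ, 0 < c ∧ ∀ x : ℝ, c ≤ deriv (deriv V) x) :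
    ∃ (a b : ℝ) (ψ : ℝ → ℝ) (ℓ : ℝ), OneCutData V a b ψ ℓ := by
  obtain ⟨c, hc, hconv⟩ := hconv
  have h₁ : ∀ x, AnalyticAt ℝ (deriv V) x := fun x => (hanalytic x).deriv
  have h₂ : ∀ x, AnalyticAt ℝ (deriv (deriv V)) x := fun x => (h₁ x).deriv
  have h₃ : ∀ x, AnalyticAt ℝ (deriv (deriv (deriv V))) x := fun x => (h₂ x).deriv
  have hV : OneCut.ConvexField c (fun x => V x - x / 2) (fun x => deriv V x - 1 / 2)
      (deriv (deriv V)) (deriv (deriv (deriv V))) :=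
    { pos := hc
      hasDeriv := fun x => (hanalytic x).differentiableAt.hasDerivAt.sub
        ((hasDerivAt_id x).div_const 2)
      hasDeriv₁ := fun x => (h₁ x).differentiableAt.hasDerivAt.sub_const _
      hasDeriv₂ := fun x => (h₂ x).differentiableAt.hasDerivAt
      cont₃ := continuous_iff_continuousAt.2 fun x => (h₃ x).continuousAt
      le₂ := hconv }
  simpa only [sub_add_cancel] using hV.exists_oneCutData
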